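/- Let G be an Artin group with all labels m_{ij} ≥ 4. A freely reduced word w in F(a₁,…,aₙ) is called Artin-reduced if w contains no subword v that is also a subword of some r ∈ 𝓡_{ij} with r = vu and ‖u‖ ≤ 3. Then every Artin-reduced word represents a nontrivial element of G, except the empty word; in particular, distinct Artin-reduced words that are both words in a fixed free group F(a₁,…,aₙ) and represent the same element of G can differ. More precisely: if w is Artin-reduced and nonempty, then w ≠ 1 in G. -/

import Mathlib

/-- The alternating word `x y x y ⋯` with `m` letters, in the free group. -/
def altWord {σ : Type*} (x y : σ) : ℕ → FreeGroup σ
  | 0 => 1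
  | m + 1 => FreeGroup.of x * altWord y x m

/-- The syllable length `‖w‖`: the number of maximal blocks of the form `a^n`
in the reduced word representing `w`. -/
def syll {σ : Type*} [DecidableEq σ] (w : FreeGroup σ) : ℕ :=
  ((w.toWord.map Prod.fst).destutter (· ≠ ·)).length

/-- An element of a free group is cyclically reduced if, in its reduced word, the
first letter is not the inverse of the last letter. -/
def CyclicallyReduced {σ : Type*} [DecidableEq σ] (w : FreeGroup σ) : Prop :=
  ∀ x y, w.toWord.head? = some x → w.toWord.getLast? = some y → x ≠ (y.1, !y.2)

/-- The defining relators `u_{ij} u_{ji}⁻¹` of the Artin group with Coxeter-type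
labels `M : Fin n → Fin n → ℕ∞` (relations with `M i j = ∞` are omitted). -/
def artinRels (n : ℕ) (M : Fin n → Fin n → ℕ∞) : Set (FreeGroup (Fin n)) :=
  { r | ∃ i j : Fin n, i ≠ j ∧ ∃ m : ℕ, M i j = (m : ℕ∞) ∧
      r = altWord i j m * (altWord j i m)⁻¹ }

/-- The quotient map from the free group onto the Artin group with labels `M`. -/
def artinMk (n : ℕ) (M : Fin n → Fin n → ℕ∞) :
    FreeGroup (Fin n) →* PresentedGroup (artinRels n M) :=
  PresentedGroup.mk _

/-- The quotient map from `F(a,b)` onto the two-generator Artin group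
`⟨a, b | aba⋯ = bab⋯⟩` with `m` letters on each side (`false ↦ a`, `true ↦ b`). -/
def twoGenArtinMk (m : ℕ) :
    FreeGroup Bool →* PresentedGroup
      ({ altWord false true m * (altWord true false m)⁻¹ } : Set (FreeGroup Bool)) :=
  PresentedGroup.mk _


/-- A freely reduced word `w` in `F(a₁,…,aₙ)` is Artin-reduced if it contains no
subword `v` which is also a subword of some relator `r ∈ 𝓡_{ij}` with `r = v u`
and `‖u‖ ≤ 3`. -/
def ArtinReduced (n : ℕ) (M : Fin n → Fin n → ℕ∞) (w : FreeGroup (Fin n)) : Prop :=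
  ¬ ∃ (i j : Fin n) (mij : ℕ), i ≠ j ∧ M i j = (mij : ℕ∞) ∧
      ∃ r : FreeGroup Bool, r ≠ 1 ∧ CyclicallyReduced r ∧ twoGenArtinMk mij r = 1 ∧
        ∃ v u : FreeGroup (Fin n),
          (FreeGroup.map (fun b => if b then j else i) r).toWord =
            v.toWord ++ u.toWord ∧
          v.toWord <:+: w.toWord ∧
          syll u ≤ 3

namespace ArtinAux

/-- A system of rank-two groups glued along cyclic subgroups. -/
structure Sys (I : Type) where
  E : Type
  A : E → Type
  grp : ∀ e, Group (A e)
  mem : E → I → Prop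
  gen : ∀ e, I → A e
  edge_ex : ∀ i j, i ≠ j → ∃ e, mem e i ∧ mem e j
  edge_uniq : ∀ {i j e e'}, i ≠ j → mem e i → mem e j → mem e' i → mem e' j → e = e'
  two : ∀ {e i j k}, mem e i → mem e j → i ≠ j → mem e k → k = i ∨ k = j
  nonempty : ∀ e, ∃ i, mem e i
  g1 : ∀ {e i} {n : ℤ}, mem e i → gen e i ^ n = 1 → n = 0
  g2 : ∀ {e i j} {n m : ℤ}, mem e i → mem e j → i ≠ j → gen e i ^ n = gen e j ^ m → n = 0
  g4 : ∀ {e i j} {p q r s : ℤ}, mem e i → mem e j → i ≠ j →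
    gen e i ^ p * gen e j ^ q = gen e j ^ s * gen e i ^ r → p = 0 ∨ q = 0

attribute [instance] Sys.grp

variable {I : Type} (S : Sys I)

/-- Partial sets with integer actions. -/
structure Pre (I : Type) (X : Type) where
  L : I → X → Prop
  s : I → ℤ → X → X
  s_zero : ∀ i x, s i 0 x = x
  s_add : ∀ i m n x, s i m (s i n x) = s i (m + n) x
  s_fix : ∀ i n x, ¬ L i x → s i n x = x
  L_s : ∀ i n x, L i x → L i (s i n x)

theorem Pre.L_s_iff {I X : Type} (P : Pre I X) (i : I) (n : ℤ) (x : X) :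
    P.L i (P.s i n x) ↔ P.L i x := by
  constructor
  · intro h
    have := P.L_s i (-n) _ h
    rwa [P.s_add, neg_add_cancel, P.s_zero] at this
  · exact P.L_s i n x

theorem Pre.s_inj {I X : Type} (P : Pre I X) {i : I} {n : ℤ} {x y : X}
    (h : P.s i n x = P.s i n y) : x = y := by
  have := congrArg (P.s i (-n)) h
  simpa [P.s_add, P.s_zero] using this

structure Good1 (X : Type) extends Pre I X where
  L_ex : ∀ x, ∃ i, L i x
  L_two : ∀ {i j x}, L i x → L j x → i ≠ j → ∀ k, L k x
  K : S.E → Type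
  kap : ∀ e, X → K e
  phi : ∀ e, X → S.A e
  kap_s : ∀ {e i} (n : ℤ) {x}, S.mem e i → L i x → kap e (s i n x) = kap e x
  phi_s : ∀ {e i} (n : ℤ) {x}, S.mem e i → L i x → phi e (s i n x) = S.gen e i ^ n * phi e x
  inj : ∀ {e x y}, (∃ i, S.mem e i ∧ L i x) → (∃ i, S.mem e i ∧ L i y) →
    kap e x = kap e y → phi e x = phi e y → x = y
  conv : ∀ {e x y i} {n : ℤ}, (∃ i, S.mem e i ∧ L i x) → (∃ i, S.mem e i ∧ L i y) →
    kap e x = kap e y → S.mem e i → n ≠ 0 → phi e y = S.gen e i ^ n * phi e x → L i x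

structure Good2 (X : Type) extends Pre I X where
  K : S.E → Type
  kap : ∀ e, X → K e ⊕ X
  phi : ∀ e, X → S.A e
  kap_s : ∀ {e i} (n : ℤ) {x}, S.mem e i → L i x → kap e (s i n x) = kap e x
  phi_s : ∀ {e i} (n : ℤ) {x}, S.mem e i → L i x → phi e (s i n x) = S.gen e i ^ n * phi e x
  full_L : ∀ {e i x c}, kap e x = Sum.inl c → S.mem e i → L i x
  full_inj : ∀ {e x y c}, kap e x = Sum.inl c → kap e y = Sum.inl c → phi e x = phi e y → x = y
  small : ∀ {e x r}, kap e x = Sum.inr r → ∃ i n, S.mem e i ∧ x = s i n r ∧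
    phi e x = S.gen e i ^ n ∧ (n = 0 ∨ L i r)

variable {S}

section StepA

variable {C : Type} (P : Good2 S C)

/-- core points and whiskers -/
inductive WY : Type
  | core (z : C) : WY
  | wh (z : C) (k : I) (n : ℤ) (h : ¬ P.L k z ∧ n ≠ 0) : WY

abbrev core (z : C) : WY P := WY.core z

open Classical in
noncomputable def mkp (z : C) (k : I) (n : ℤ) : WY P :=
  if h : ¬ P.L k z ∧ n ≠ 0 then WY.wh z k n h else WY.core z

theorem mkp_zero (z : C) (k : I) : mkp P z k 0 = core P z := by
  simp [mkp, core]

theorem mkp_pos {z : C} {k : I} {n : ℤ} (h : ¬ P.L k z) (hn : n ≠ 0) :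
    mkp P z k n = WY.wh z k n ⟨h, hn⟩ := by
  unfold mkp
  rw [dif_pos ⟨h, hn⟩]

theorem mkp_cases (z : C) (k : I) (n : ℤ) : mkp P z k n = core P z ∨
    ∃ h, mkp P z k n = WY.wh z k n h := by
  unfold mkp
  split_ifs with h
  · exact Or.inr ⟨h, rfl⟩
  · exact Or.inl rfl

theorem WY_cases (y : WY P) : (∃ z, y = core P z) ∨
    ∃ z k n, ¬ P.L k z ∧ n ≠ 0 ∧ y = mkp P z k n := by
  rcases y with z | ⟨z, k, n, h⟩
  · exact Or.inl ⟨z, rfl⟩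
  · exact Or.inr ⟨z, k, n, h.1, h.2, (mkp_pos P h.1 h.2).symm⟩

open Classical in
noncomputable def WY_s (i : I) (m : ℤ) : WY P → WY P
  | WY.core z => if P.L i z then core P (P.s i m z) else mkp P z i m
  | WY.wh z k n h => if i = k then mkp P z i (m + n) else WY.wh z k n h

def WY_L (i : I) : WY P → Prop
  | WY.core _ => True
  | WY.wh _ k _ _ => i = k

def WY_kap (e : S.E) : WY P → P.K e ⊕ C
  | WY.core z => P.kap e z
  | WY.wh z _ _ _ => P.kap e z

def WY_phi (e : S.E) : WY P → S.A e
  | WY.core z => P.phi e z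
  | WY.wh z k n _ => S.gen e k ^ n * P.phi e z

theorem WY_L_core (i : I) (z : C) : WY_L P i (core P z) := trivial

theorem WY_L_mkp {i k : I} {z : C} {n : ℤ} (h : ¬ P.L k z) (hn : n ≠ 0) :
    WY_L P i (mkp P z k n) ↔ i = k := by
  rw [mkp_pos P h hn]; rfl

theorem WY_L_mkp' (k : I) (z : C) (n : ℤ) : WY_L P k (mkp P z k n) := by
  rcases mkp_cases P z k n with h | ⟨h, h'⟩
  · rw [h]; trivial
  · rw [h']; rfl

theorem WY_kap_mkp (e : S.E) (k : I) (z : C) (n : ℤ) :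
    WY_kap P e (mkp P z k n) = P.kap e z := by
  rcases mkp_cases P z k n with h | ⟨h, h'⟩
  · rw [h]; rfl
  · rw [h']; rfl

theorem WY_phi_mkp (e : S.E) {k : I} {z : C} (n : ℤ) (h : ¬ P.L k z) :
    WY_phi P e (mkp P z k n) = S.gen e k ^ n * P.phi e z := by
  by_cases hn : n = 0
  · subst hn; rw [mkp_zero, zpow_zero, one_mul]; rfl
  · rw [mkp_pos P h hn]; rfl

theorem WY_s_core_pos {i : I} {z : C} (m : ℤ) (h : P.L i z) :
    WY_s P i m (core P z) = core P (P.s i m z) := by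
  simp only [WY_s, core]; rw [if_pos h]

theorem WY_s_mkp {i : I} {z : C} (m n : ℤ) (h : ¬ P.L i z) :
    WY_s P i m (mkp P z i n) = mkp P z i (m + n) := by
  by_cases hn : n = 0
  · subst hn; rw [mkp_zero]; simp only [WY_s, core]; rw [if_neg h, add_zero]
  · rw [mkp_pos P h hn]
    simp [WY_s]

theorem WY_s_mkp_ne {i k : I} {z : C} (m : ℤ) {n : ℤ} (h : ¬ P.L k z) (hn : n ≠ 0)
    (hik : i ≠ k) : WY_s P i m (mkp P z k n) = mkp P z k n := by
  rw [mkp_pos P h hn]; simp [WY_s, hik]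

noncomputable def WY_pre : Pre I (WY P) where
  L := WY_L P
  s := WY_s P
  s_zero i x := by
    rcases WY_cases P x with ⟨z, rfl⟩ | ⟨z, k, n, h, hn, rfl⟩
    · by_cases hz : P.L i z
      · rw [WY_s_core_pos P _ hz, P.s_zero]
      · rw [← mkp_zero P z i, WY_s_mkp P _ _ hz, add_zero]
    · by_cases hik : i = k
      · subst hik; rw [WY_s_mkp P _ _ h, zero_add]
      · rw [WY_s_mkp_ne P _ h hn hik]
  s_add i m n x := by
    rcases WY_cases P x with ⟨z, rfl⟩ | ⟨z, k, l, h, hn, rfl⟩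
    · by_cases hz : P.L i z
      · rw [WY_s_core_pos P _ hz, WY_s_core_pos P _ hz, WY_s_core_pos P _ (P.L_s _ _ _ hz), P.s_add]
      · rw [← mkp_zero P z i, WY_s_mkp P _ _ hz, WY_s_mkp P _ _ hz, WY_s_mkp P _ _ hz, add_assoc]
    · by_cases hik : i = k
      · subst hik; rw [WY_s_mkp P _ _ h, WY_s_mkp P _ _ h, WY_s_mkp P _ _ h, add_assoc]
      · rw [WY_s_mkp_ne P _ h hn hik, WY_s_mkp_ne P _ h hn hik, WY_s_mkp_ne P _ h hn hik]
  s_fix i n x hx := by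
    rcases WY_cases P x with ⟨z, rfl⟩ | ⟨z, k, l, h, hn, rfl⟩
    · exact absurd (WY_L_core P i z) hx
    · rw [WY_L_mkp P h hn] at hx
      rw [WY_s_mkp_ne P _ h hn hx]
  L_s i n x hx := by
    rcases WY_cases P x with ⟨z, rfl⟩ | ⟨z, k, l, h, hn, rfl⟩
    · by_cases hz : P.L i z
      · rw [WY_s_core_pos P _ hz]; trivial
      · rw [← mkp_zero P z i, WY_s_mkp P _ _ hz]; apply WY_L_mkp'
    · rw [WY_L_mkp P h hn] at hx
      subst hx
      rw [WY_s_mkp P _ _ h]; apply WY_L_mkp'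

/-- position of a whisker over a small component -/
theorem small_wh {e : S.E} {z r : C} {k : I} (hk : S.mem e k) (hz : ¬ P.L k z)
    (h : P.kap e z = Sum.inr r) :
    (z = r ∧ P.phi e z = 1) ∨
    ∃ i n, S.mem e i ∧ i ≠ k ∧ n ≠ 0 ∧ z = P.s i n r ∧ P.phi e z = S.gen e i ^ n ∧ P.L i r := by
  obtain ⟨i, n, hi, h1, h2, h3⟩ := P.small h
  by_cases hn : n = 0
  · subst hn; left; rw [h1, P.s_zero]; refine ⟨rfl, ?_⟩
    rw [P.s_zero] at h1; rw [← h1, h2, zpow_zero]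
  · right
    have hr : P.L i r := h3.resolve_left hn
    refine ⟨i, n, hi, ?_, hn, h1, h2, hr⟩
    rintro rfl
    exact hz (h1 ▸ P.L_s _ _ _ hr)

theorem core_core {e : S.E} {z z' : C} (h : P.kap e z = P.kap e z') (hp : P.phi e z = P.phi e z') :
    z = z' := by
  rcases h1 : P.kap e z with c | r
  · exact P.full_inj h1 (h ▸ h1) hp
  · obtain ⟨i, n, hi, e1, e2, e3⟩ := P.small h1
    obtain ⟨j, m, hj, f1, f2, f3⟩ := P.small (h ▸ h1)
    rw [e2, f2] at hp
    by_cases hij : i = j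
    · subst hij
      have : S.gen e i ^ (n - m) = 1 := by rw [zpow_sub, hp, mul_inv_cancel]
      have := S.g1 hi this
      have : n = m := by omega
      subst this; rw [e1, f1]
    · have hn := S.g2 hi hj hij hp
      have hm := S.g2 hj hi (Ne.symm hij) hp.symm
      subst hn hm
      rw [e1, f1, P.s_zero, P.s_zero]

theorem wh_core {e : S.E} {z z' : C} {k : I} {m : ℤ} (hk : S.mem e k) (hz : ¬ P.L k z)
    (h : P.kap e z = P.kap e z') (hp : S.gen e k ^ m * P.phi e z = P.phi e z') : m = 0 := by
  rcases h1 : P.kap e z with c | r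
  · exact absurd (P.full_L h1 hk) hz
  · obtain ⟨j, q, hj, f1, f2, f3⟩ := P.small (h ▸ h1)
    rw [f2] at hp
    rcases small_wh P hk hz h1 with ⟨e1, e2⟩ | ⟨i, n, hi, hik, hn, e1, e2, e3⟩
    · rw [e2, mul_one] at hp
      by_cases hkj : k = j
      · subst hkj
        rcases f3 with rfl | f3
        · rw [zpow_zero] at hp; exact S.g1 hk hp
        · exact absurd (e1 ▸ f3) hz
      · exact S.g2 hk hj hkj hp
    · rw [e2] at hp
      rcases S.two hi hk hik hj with rfl | rfl
      · exact S.g2 (m := q - n) hk hj (Ne.symm hik) (by rw [zpow_sub, ← hp]; group)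
      · exact absurd (S.g2 (m := q - m) hi hk hik (by
          rw [sub_eq_neg_add, zpow_add, ← hp]; group)) hn

theorem wh_wh {e : S.E} {z z' : C} {k k' : I} {m m' : ℤ} (hk : S.mem e k) (hk' : S.mem e k')
    (hz : ¬ P.L k z) (hz' : ¬ P.L k' z') (hm : m ≠ 0) (hm' : m' ≠ 0)
    (h : P.kap e z = P.kap e z')
    (hp : S.gen e k ^ m * P.phi e z = S.gen e k' ^ m' * P.phi e z') :
    z = z' ∧ k = k' ∧ m = m' := by
  by_cases hkk : k = k'
  · subst hkk
    have : S.gen e k ^ (m - m') * P.phi e z = P.phi e z' := by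
      rw [sub_eq_neg_add, zpow_add, mul_assoc, hp]; group
    have h0 := wh_core P hk hz h this
    rw [h0, zpow_zero, one_mul] at this
    exact ⟨core_core P h this, rfl, by omega⟩
  · exfalso
    rcases h1 : P.kap e z with c | r
    · exact absurd (P.full_L h1 hk) hz
    have key : ∀ {z : C} {k k' : I}, S.mem e k → S.mem e k' → k ≠ k' → ¬ P.L k z →
        P.kap e z = Sum.inr r → ∃ n : ℤ, P.phi e z = S.gen e k' ^ n := by
      intro z k k' hk hk' hkk hz h1
      rcases small_wh P hk hz h1 with ⟨e1, e2⟩ | ⟨i, n, hi, hik, hn, e1, e2, e3⟩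
      · exact ⟨0, by simpa using e2⟩
      · rcases S.two hk hk' hkk hi with rfl | rfl
        · exact absurd rfl hik
        · exact ⟨n, e2⟩
    obtain ⟨n, hn⟩ := key hk hk' hkk hz h1
    obtain ⟨n', hn'⟩ := key hk' hk (Ne.symm hkk) hz' (h ▸ h1)
    rw [hn, hn'] at hp
    have a1 := (S.g4 hk hk' hkk hp).resolve_left hm
    have a2 := (S.g4 hk' hk (Ne.symm hkk) hp.symm).resolve_left hm'
    subst a1 a2
    simp only [zpow_zero, mul_one] at hp
    exact hm (S.g2 hk hk' hkk hp)

/-- the convexity step for whiskers -/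
theorem wh_conv {e : S.E} {z z' : C} {k i : I} {m n : ℤ} (hk : S.mem e k) (hi : S.mem e i)
    (hik : i ≠ k) (hz : ¬ P.L k z) (hm : m ≠ 0) (hn : n ≠ 0)
    (h : P.kap e z = P.kap e z') (k' : I) (hk' : S.mem e k') (m' : ℤ)
    (hz' : m' = 0 ∨ ¬ P.L k' z')
    (hp : S.gen e k' ^ m' * P.phi e z' = S.gen e i ^ n * (S.gen e k ^ m * P.phi e z)) : False := by
  rcases h1 : P.kap e z with c | r
  · exact absurd (P.full_L h1 hk) hz
  -- phi z = gen i ^ n1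
  have hA : ∃ n1 : ℤ, P.phi e z = S.gen e i ^ n1 ∧ (n1 = 0 → z = r) := by
    rcases small_wh P hk hz h1 with ⟨e1, e2⟩ | ⟨i', n', hi', hik', hn', e1, e2, e3⟩
    · exact ⟨0, by simpa using e2, fun _ => e1⟩
    · rcases S.two hi hk hik hi' with rfl | rfl
      · exact ⟨n', e2, fun h => absurd h hn'⟩
      · exact absurd rfl hik'
  obtain ⟨n1, hn1, hn1r⟩ := hA
  -- the other side
  have hB : (∃ s t : ℤ, S.gen e k' ^ m' * P.phi e z' = S.gen e k ^ t * S.gen e i ^ s) ∨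
      (∃ s t : ℤ, S.gen e k' ^ m' * P.phi e z' = S.gen e i ^ s * S.gen e k ^ t ∧
        (t ≠ 0 → s ≠ 0 → P.L k r)) := by
    obtain ⟨j, q, hj, f1, f2, f3⟩ := P.small (h ▸ h1)
    rw [f2]
    rcases S.two hi hk hik hk' with rfl | rfl
    · rcases S.two hi hk hik hj with rfl | rfl
      · left; exact ⟨m' + q, 0, by rw [zpow_zero, one_mul, zpow_add]⟩
      · right; exact ⟨m', q, rfl, fun h _ => f3.resolve_left h⟩
    · rcases S.two hi hk hik hj with rfl | rfl
      · left; exact ⟨q, m', rfl⟩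
      · left; exact ⟨0, m' + q, by rw [zpow_zero, mul_one, zpow_add]⟩
  rw [hn1] at hp
  rcases hB with ⟨s, t, hB⟩ | ⟨s, t, hB, hL⟩
  · rw [hB] at hp
    have : S.gen e i ^ n * S.gen e k ^ m = S.gen e k ^ t * S.gen e i ^ (s - n1) := by
      rw [zpow_sub, ← mul_assoc, hp]; group
    rcases S.g4 hi hk hik this with h | h
    · exact hn h
    · exact hm h
  · rw [hB] at hp
    have h2 : S.gen e i ^ (n - s) * S.gen e k ^ m = S.gen e k ^ t * S.gen e i ^ (-n1) := by
      have : S.gen e k ^ t = S.gen e i ^ (-s) *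
          (S.gen e i ^ n * (S.gen e k ^ m * S.gen e i ^ n1)) := by
        rw [← hp]; group
      rw [this]; group
    have h3 : n - s = 0 := (S.g4 hi hk hik h2).resolve_right hm
    rw [h3, zpow_zero, one_mul] at h2
    have h4 : S.gen e k ^ (m - t) = S.gen e i ^ (-n1) := by
      rw [sub_eq_neg_add, zpow_add, h2]; group
    have h5 := S.g2 hk hi (Ne.symm hik) h4
    have h6 := S.g2 hi hk hik h4.symm
    have : P.L k r := hL (by omega) (by omega)
    exact hz ((hn1r (by omega)) ▸ this)

noncomputable def stepA [Nonempty I] : Good1 S (WY P) where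
  toPre := WY_pre P
  L_ex x := by
    rcases WY_cases P x with ⟨z, rfl⟩ | ⟨z, k, n, h, hn, rfl⟩
    · exact ⟨Classical.arbitrary I, trivial⟩
    · exact ⟨k, WY_L_mkp' P k z n⟩
  L_two {i j x} hi hj hij k := by
    rcases WY_cases P x with ⟨z, rfl⟩ | ⟨z, k, n, h, hn, rfl⟩
    · trivial
    · exact absurd (((WY_L_mkp P h hn).1 hi).trans ((WY_L_mkp P h hn).1 hj).symm) hij
  K e := P.K e ⊕ C
  kap := WY_kap P
  phi := WY_phi P
  kap_s {e i} n x he hL := by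
    change WY_L P i x at hL
    change WY_kap P e (WY_s P i n x) = WY_kap P e x
    rcases WY_cases P x with ⟨z, rfl⟩ | ⟨z, k, l, h, hn, rfl⟩
    · by_cases hz : P.L i z
      · rw [WY_s_core_pos P _ hz]; exact P.kap_s n he hz
      · rw [← mkp_zero P z i, WY_s_mkp P _ _ hz, WY_kap_mkp, WY_kap_mkp]
    · obtain rfl := (WY_L_mkp P h hn).1 hL
      rw [WY_s_mkp P _ _ h, WY_kap_mkp, WY_kap_mkp]
  phi_s {e i} n x he hL := by
    change WY_L P i x at hL
    change WY_phi P e (WY_s P i n x) = _ * WY_phi P e x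
    rcases WY_cases P x with ⟨z, rfl⟩ | ⟨z, k, l, h, hn, rfl⟩
    · by_cases hz : P.L i z
      · rw [WY_s_core_pos P _ hz]; exact P.phi_s n he hz
      · rw [← mkp_zero P z i, WY_s_mkp P _ _ hz, WY_phi_mkp P e _ hz, WY_phi_mkp P e _ hz]; simp
    · obtain rfl := (WY_L_mkp P h hn).1 hL
      rw [WY_s_mkp P _ _ h, WY_phi_mkp P e _ h, WY_phi_mkp P e _ h, zpow_add, mul_assoc]
  inj {e x y} hx hy hk hp := by
    obtain ⟨i, hi, hLi⟩ := hx
    obtain ⟨j, hj, hLj⟩ := hy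
    change WY_L P i x at hLi
    change WY_L P j y at hLj
    rcases WY_cases P x with ⟨z, rfl⟩ | ⟨z, k, l, h, hn, rfl⟩
    · rcases WY_cases P y with ⟨z', rfl⟩ | ⟨z', k', l', h', hn', rfl⟩
      · rw [core_core P hk hp]
      · obtain rfl := (WY_L_mkp P h' hn').1 hLj
        rw [WY_kap_mkp] at hk
        rw [WY_phi_mkp P e _ h'] at hp
        exact absurd (wh_core P hj h' hk.symm hp.symm) hn'
    · obtain rfl := (WY_L_mkp P h hn).1 hLi
      rw [WY_kap_mkp] at hk
      rw [WY_phi_mkp P e _ h] at hp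
      rcases WY_cases P y with ⟨z', rfl⟩ | ⟨z', k', l', h', hn', rfl⟩
      · exact absurd (wh_core P hi h hk hp) hn
      · obtain rfl := (WY_L_mkp P h' hn').1 hLj
        rw [WY_kap_mkp] at hk
        rw [WY_phi_mkp P e _ h'] at hp
        obtain ⟨rfl, rfl, rfl⟩ := wh_wh P hi hj h h' hn hn' hk hp
        rfl
  conv {e x y i n} hx hy hk hi hn hp := by
    obtain ⟨i', hi', hLi⟩ := hx
    obtain ⟨j, hj, hLj⟩ := hy
    change WY_L P i' x at hLi
    change WY_L P j y at hLj
    change WY_L P i x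
    rcases WY_cases P x with ⟨z, rfl⟩ | ⟨z, k, l, h, hn2, rfl⟩
    · trivial
    · obtain rfl := (WY_L_mkp P h hn2).1 hLi
      rw [WY_L_mkp P h hn2]
      by_contra hik
      rw [WY_kap_mkp] at hk
      rw [WY_phi_mkp P e _ h] at hp
      rcases WY_cases P y with ⟨z', rfl⟩ | ⟨z', k', l', h', hn', rfl⟩
      · refine wh_conv P hi' hi hik h hn2 hn hk i hi 0 (Or.inl rfl) ?_
        rw [zpow_zero, one_mul]; exact hp
      · obtain rfl := (WY_L_mkp P h' hn').1 hLj
        rw [WY_kap_mkp] at hk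
        rw [WY_phi_mkp P e _ h'] at hp
        exact wh_conv P hi' hi hik h hn2 hn hk j hj l' (Or.inr h') hp

end StepA

section StepB

variable {X : Type} (P : Good1 S X)

def att (e : S.E) (x : X) : Prop := ∃ i, S.mem e i ∧ P.L i x

/-- old points and fresh points -/
inductive CB : Type
  | old (x : X) : CB
  | fresh (e : S.E) (c : P.K e) (g : S.A e)
      (h : ¬ ∃ x, att P e x ∧ P.kap e x = c ∧ P.phi e x = g) : CB

open Classical in
noncomputable def psi (e : S.E) (c : P.K e) (g : S.A e) : CB P :=
  if h : ∃ x, att P e x ∧ P.kap e x = c ∧ P.phi e x = g then CB.old h.choose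
  else CB.fresh e c g h

theorem psi_cases (e : S.E) (c : P.K e) (g : S.A e) :
    (∃ x, att P e x ∧ P.kap e x = c ∧ P.phi e x = g ∧ psi P e c g = CB.old x) ∨
    ∃ h, psi P e c g = CB.fresh e c g h := by
  unfold psi
  split_ifs with h
  · exact Or.inl ⟨h.choose, h.choose_spec.1, h.choose_spec.2.1, h.choose_spec.2.2, rfl⟩
  · exact Or.inr ⟨h, rfl⟩

theorem psi_old {e : S.E} {x : X} (hx : att P e x) : psi P e (P.kap e x) (P.phi e x) = CB.old x := by
  rcases psi_cases P e (P.kap e x) (P.phi e x) with ⟨y, hy, h1, h2, h3⟩ | ⟨h, _⟩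
  · rw [h3, P.inj hy hx h1 h2]
  · exact absurd ⟨x, hx, rfl, rfl⟩ h

theorem psi_fresh {e : S.E} {c : P.K e} {g : S.A e}
    (h : ¬ ∃ x, att P e x ∧ P.kap e x = c ∧ P.phi e x = g) :
    psi P e c g = CB.fresh e c g h := by
  unfold psi; rw [dif_neg h]

theorem psi_inj {e : S.E} {c c' : P.K e} {g g' : S.A e} (h : psi P e c g = psi P e c' g') :
    c = c' ∧ g = g' := by
  rcases psi_cases P e c g with ⟨y, hy, h1, h2, h3⟩ | ⟨h1, h2⟩ <;>
  rcases psi_cases P e c' g' with ⟨y', hy', h1', h2', h3'⟩ | ⟨h1', h2'⟩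
  · rw [h3, h3'] at h
    injection h with h
    subst h
    exact ⟨h1.symm.trans h1', h2.symm.trans h2'⟩
  · rw [h3, h2'] at h; cases h
  · rw [h2, h3'] at h; cases h
  · rw [h2, h2'] at h
    cases h; exact ⟨rfl, rfl⟩

theorem att_s {e : S.E} {x : X} {i : I} {n : ℤ} (hi : S.mem e i) (hL : P.L i x) :
    att P e (P.s i n x) := ⟨i, hi, P.L_s _ _ _ hL⟩

theorem att_ex {x : X} {i : I} (h : ¬ P.L i x) : ∃ e, S.mem e i ∧ att P e x := by
  obtain ⟨j, hj⟩ := P.L_ex x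
  have hij : i ≠ j := by rintro rfl; exact h hj
  obtain ⟨e, h1, h2⟩ := S.edge_ex i j hij
  exact ⟨e, h1, j, h2, hj⟩

theorem att_uniq {x : X} {i : I} (h : ¬ P.L i x) {e e' : S.E} (h1 : S.mem e i) (h2 : S.mem e' i)
    (h3 : att P e x) (h4 : att P e' x) : e = e' := by
  obtain ⟨j, hj, hL⟩ := h3
  obtain ⟨j', hj', hL'⟩ := h4
  have hij : i ≠ j := by rintro rfl; exact h hL
  by_cases hjj : j = j'
  · subst hjj; exact S.edge_uniq hij h1 hj h2 hj'
  · exact absurd (P.L_two hL hL' hjj i) h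

open Classical in
noncomputable def st (i : I) (n : ℤ) : CB P → CB P
  | CB.old x => if P.L i x then CB.old (P.s i n x) else
      if h : ∃ e, S.mem e i ∧ att P e x then
        psi P h.choose (P.kap h.choose x) (S.gen h.choose i ^ n * P.phi h.choose x) else CB.old x
  | CB.fresh e c g h => if S.mem e i then psi P e c (S.gen e i ^ n * g) else CB.fresh e c g h

def LC (i : I) : CB P → Prop
  | CB.old _ => True
  | CB.fresh e _ _ _ => S.mem e i

theorem st_L {i : I} {n : ℤ} {x : X} (h : P.L i x) : st P i n (CB.old x) = CB.old (P.s i n x) := by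
  simp only [st]; rw [if_pos h]

theorem st_old {e : S.E} {i : I} (n : ℤ) {x : X} (hi : S.mem e i) (hx : att P e x) :
    st P i n (CB.old x) = psi P e (P.kap e x) (S.gen e i ^ n * P.phi e x) := by
  by_cases hL : P.L i x
  · rw [st_L P hL, ← psi_old P (att_s P hi hL), P.kap_s n hi hL, P.phi_s n hi hL]
  · have hex : ∃ e, S.mem e i ∧ att P e x := ⟨e, hi, hx⟩
    have := att_uniq P hL hi hex.choose_spec.1 hx hex.choose_spec.2
    simp only [st]
    rw [if_neg hL, dif_pos hex]
    generalize hex.choose = e' at this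
    subst this
    rfl

theorem st_psi {e : S.E} {i : I} (n : ℤ) (hi : S.mem e i) (c : P.K e) (g : S.A e) :
    st P i n (psi P e c g) = psi P e c (S.gen e i ^ n * g) := by
  rcases psi_cases P e c g with ⟨y, hy, h1, h2, h3⟩ | ⟨h1, h2⟩
  · rw [h3, st_old P n hi hy, h1, h2]
  · rw [h2]; simp only [st]; rw [if_pos hi]

theorem LC_psi {e : S.E} {i : I} (hi : S.mem e i) (c : P.K e) (g : S.A e) :
    LC P i (psi P e c g) := by
  rcases psi_cases P e c g with ⟨y, hy, h1, h2, h3⟩ | ⟨h1, h2⟩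
  · rw [h3]; trivial
  · rw [h2]; exact hi

theorem LC_cases {i : I} {z : CB P} (h : LC P i z) :
    (∃ e c g, S.mem e i ∧ z = psi P e c g) ∨ ∃ x, z = CB.old x ∧ P.L i x := by
  rcases z with x | ⟨e, c, g, h1⟩
  · by_cases hL : P.L i x
    · exact Or.inr ⟨x, rfl, hL⟩
    · obtain ⟨e, h1, h2⟩ := att_ex P hL
      exact Or.inl ⟨e, _, _, h1, (psi_old P h2).symm⟩
  · exact Or.inl ⟨e, c, g, h, (psi_fresh P h1).symm⟩

theorem st_fix {i : I} {n : ℤ} {z : CB P} (h : ¬ LC P i z) : st P i n z = z := by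
  rcases z with x | ⟨e, c, g, h1⟩
  · exact absurd trivial h
  · have h2 : ¬ S.mem e i := h
    simp only [st]; rw [if_neg h2]

noncomputable def CB_pre : Pre I (CB P) where
  L := LC P
  s := st P
  s_zero i x := by
    by_cases h : LC P i x
    · rcases LC_cases P h with ⟨e, c, g, hi, rfl⟩ | ⟨x, rfl, hL⟩
      · rw [st_psi P _ hi, zpow_zero, one_mul]
      · rw [st_L P hL, P.s_zero]
    · exact st_fix P h
  s_add i m n x := by
    by_cases h : LC P i x
    · rcases LC_cases P h with ⟨e, c, g, hi, rfl⟩ | ⟨x, rfl, hL⟩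
      · rw [st_psi P _ hi, st_psi P _ hi, st_psi P _ hi, zpow_add, mul_assoc]
      · rw [st_L P hL, st_L P hL, st_L P (P.L_s _ _ _ hL), P.s_add]
    · rw [st_fix P h, st_fix P h, st_fix P h]
  s_fix i n x h := st_fix P h
  L_s i n x h := by
    rcases LC_cases P h with ⟨e, c, g, hi, rfl⟩ | ⟨x, rfl, hL⟩
    · rw [st_psi P _ hi]; exact LC_psi P hi _ _
    · rw [st_L P hL]; trivial

theorem st_add (i : I) (m n : ℤ) (x : CB P) : st P i m (st P i n x) = st P i (m + n) x :=
  (CB_pre P).s_add i m n x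

theorem st_zero (i : I) (x : CB P) : st P i 0 x = x := (CB_pre P).s_zero i x

theorem LC_st (i : I) (n : ℤ) (x : CB P) : LC P i (st P i n x) ↔ LC P i x :=
  (CB_pre P).L_s_iff i n x

theorem old_small {i : I} {n : ℤ} {x y : X} (hL : ¬ P.L i x)
    (h : CB.old y = st P i n (CB.old x)) : n = 0 := by
  by_contra hn
  obtain ⟨d, hd, hx⟩ := att_ex P hL
  rw [st_old P n hd hx] at h
  rcases psi_cases P d (P.kap d x) (S.gen d i ^ n * P.phi d x) with ⟨y', hy, h1, h2, h3⟩ | ⟨h1, h2⟩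
  · exact hL (P.conv hx hy h1.symm hd hn h2)
  · rw [h2] at h; cases h

def bp (i : I) (z y : CB P) : Prop :=
  (∃ n, y = st P i n z) ∧ ((∃ x n, CB.old x = st P i n z) → ∃ x, y = CB.old x)

noncomputable def bs (i : I) (z : CB P) : CB P := @Classical.epsilon _ ⟨z⟩ (bp P i z)

theorem bs_spec (i : I) (z : CB P) : bp P i z (bs P i z) := by
  have : ∃ y, bp P i z y := by
    by_cases h : ∃ x n, CB.old x = st P i n z
    · obtain ⟨x, n, h⟩ := h
      exact ⟨CB.old x, ⟨n, h⟩, fun _ => ⟨x, rfl⟩⟩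
    · exact ⟨z, ⟨0, (st_zero P i z).symm⟩, fun h' => absurd h' h⟩
  exact @Classical.epsilon_spec _ (bp P i z) this

theorem bp_st (i : I) (m : ℤ) (z : CB P) : bp P i (st P i m z) = bp P i z := by
  have key : ∀ y, (∃ n, y = st P i n (st P i m z)) ↔ ∃ n, y = st P i n z := by
    intro y
    constructor
    · rintro ⟨n, h⟩; exact ⟨n + m, by rw [h, st_add]⟩
    · rintro ⟨n, h⟩; exact ⟨n - m, by rw [h, st_add, sub_add_cancel]⟩
  funext y
  simp only [bp, key]

theorem bs_st (i : I) (m : ℤ) (z : CB P) : bs P i (st P i m z) = bs P i z := by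
  unfold bs; congr 1; exact bp_st P i m z

theorem bs_back (i : I) (z : CB P) : ∃ n, z = st P i n (bs P i z) := by
  obtain ⟨n, h⟩ := (bs_spec P i z).1
  exact ⟨-n, by rw [h, st_add, neg_add_cancel, st_zero]⟩

theorem bs_old {i : I} {x : X} (hL : ¬ P.L i x) : bs P i (CB.old x) = CB.old x := by
  obtain ⟨⟨n, h1⟩, h2⟩ := bs_spec P i (CB.old x)
  obtain ⟨y, h3⟩ := h2 ⟨x, 0, (st_zero P i _).symm⟩
  have := old_small P hL (h3.symm.trans h1)
  rw [h1, this, st_zero]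

def full (e : S.E) (z : CB P) : Prop := ∃ c g, z = psi P e c g

open Classical in
noncomputable def kap2 (e : S.E) (z : CB P) : P.K e ⊕ CB P :=
  if h : full P e z then Sum.inl h.choose else
    if h : ∃ i, S.mem e i ∧ LC P i z then Sum.inr (bs P h.choose z) else Sum.inr z

open Classical in
noncomputable def phi2 (e : S.E) (z : CB P) : S.A e :=
  if h : full P e z then h.choose_spec.choose else
    if h : ∃ i, S.mem e i ∧ LC P i z then
      S.gen e h.choose ^ (bs_back P h.choose z).choose else 1

theorem kp_full (e : S.E) (c : P.K e) (g : S.A e) :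
    kap2 P e (psi P e c g) = Sum.inl c ∧ phi2 P e (psi P e c g) = g := by
  have h : full P e (psi P e c g) := ⟨c, g, rfl⟩
  have := psi_inj P h.choose_spec.choose_spec
  unfold kap2 phi2
  rw [dif_pos h, dif_pos h]
  exact ⟨by rw [← this.1], this.2.symm⟩

theorem kp_small {e : S.E} {i : I} {z : CB P} (hf : ¬ full P e z) (hi : S.mem e i)
    (hL : LC P i z) : kap2 P e z = Sum.inr (bs P i z) ∧
      ∀ n, z = st P i n (bs P i z) → phi2 P e z = S.gen e i ^ n := by
  have hex : ∃ i, S.mem e i ∧ LC P i z := ⟨i, hi, hL⟩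
  unfold kap2 phi2
  rw [dif_neg hf, dif_neg hf, dif_pos hex, dif_pos hex]
  have hs := hex.choose_spec
  have hn := (bs_back P hex.choose z).choose_spec
  generalize hm : (bs_back P hex.choose z).choose = m at *
  generalize hex.choose = i' at *
  clear hm
  rcases z with x | ⟨d, c, g, hfr⟩
  · have h1 : ∀ j, S.mem e j → ¬ P.L j x := fun j hj h =>
      hf ⟨_, _, (psi_old P ⟨j, hj, h⟩).symm⟩
    rw [bs_old P (h1 _ hs.1)] at hn ⊢
    rw [bs_old P (h1 _ hi)]
    refine ⟨rfl, fun n hn' => ?_⟩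
    rw [old_small P (h1 _ hi) hn', old_small P (h1 _ hs.1) hn, zpow_zero, zpow_zero]
  · have hii : i' = i := by
      by_contra hne
      have := S.edge_uniq hne hs.1 hi hs.2 hL
      subst this
      exact hf ⟨c, g, (psi_fresh P hfr).symm⟩
    subst hii
    refine ⟨rfl, fun n hn' => ?_⟩
    obtain ⟨k, hk⟩ := (bs_spec P i' (CB.fresh d c g hfr)).1
    rw [hk, ← psi_fresh P hfr, st_psi P _ hL, st_psi P _ hL] at hn hn'
    have h3 := (psi_inj P (hn.symm.trans hn')).2
    have h4 := mul_right_cancel h3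
    have h5 := S.g1 (n := m - n) hL (by rw [zpow_sub, h4, mul_inv_cancel])
    rw [show m = n by omega]

theorem full_st {e : S.E} {i : I} {n : ℤ} {z : CB P} (hi : S.mem e i) :
    full P e (st P i n z) ↔ full P e z := by
  have : ∀ n z, full P e z → full P e (st P i n z) := by
    rintro n _ ⟨c, g, rfl⟩
    exact ⟨_, _, st_psi P n hi c g⟩
  constructor
  · intro h
    have := this (-n) _ h
    rwa [st_add, neg_add_cancel, st_zero] at this
  · exact this n z

theorem kap2_inl {e : S.E} {z : CB P} {c : P.K e} (h : kap2 P e z = Sum.inl c) :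
    z = psi P e c (phi2 P e z) := by
  by_cases hf : full P e z
  · obtain ⟨c', g, rfl⟩ := hf
    have := kp_full P e c' g
    rw [this.1] at h
    cases h
    rw [this.2]
  · unfold kap2 at h
    rw [dif_neg hf] at h
    split_ifs at h

noncomputable def stepB : Good2 S (CB P) where
  toPre := CB_pre P
  K := P.K
  kap := kap2 P
  phi := phi2 P
  kap_s {e i} n z hi hL := by
    change kap2 P e (st P i n z) = kap2 P e z
    by_cases hf : full P e z
    · obtain ⟨c, g, rfl⟩ := hf
      rw [st_psi P _ hi, (kp_full P _ _ _).1, (kp_full P _ _ _).1]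
    · rw [(kp_small P hf hi hL).1, (kp_small P (mt (full_st P hi).1 hf) hi
        ((LC_st P i n z).2 hL)).1, bs_st]
  phi_s {e i} n z hi hL := by
    change phi2 P e (st P i n z) = _ * phi2 P e z
    by_cases hf : full P e z
    · obtain ⟨c, g, rfl⟩ := hf
      rw [st_psi P _ hi, (kp_full P _ _ _).2, (kp_full P _ _ _).2]
    · obtain ⟨m, hm⟩ := bs_back P i z
      rw [(kp_small P hf hi hL).2 m hm, (kp_small P (mt (full_st P hi).1 hf) hi
        ((LC_st P i n z).2 hL)).2 (n + m) (by rw [bs_st, ← st_add, ← hm]), zpow_add]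
  full_L {e i z c} h hi := by
    change LC P i z
    rw [kap2_inl P h]; exact LC_psi P hi _ _
  full_inj {e x y c} hx hy h := by
    rw [kap2_inl P hx, kap2_inl P hy, h]
  small {e z r} h := by
    have hf : ¬ full P e z := by
      rintro ⟨c, g, rfl⟩
      rw [(kp_full P _ _ _).1] at h
      cases h
    by_cases hex : ∃ i, S.mem e i ∧ LC P i z
    · obtain ⟨i, hi, hL⟩ := hex
      have := kp_small P hf hi hL
      rw [this.1] at h
      cases h
      obtain ⟨n, hn⟩ := bs_back P i z
      refine ⟨i, n, hi, hn, this.2 n hn, Or.inr ?_⟩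
      rw [hn] at hL
      exact (LC_st P i n _).1 hL
    · obtain ⟨i, hi⟩ := S.nonempty e
      refine ⟨i, 0, hi, ?_, ?_, Or.inl rfl⟩
      · unfold kap2 at h
        rw [dif_neg hf, dif_neg hex] at h
        cases h
        exact (st_zero P i z).symm
      · unfold phi2
        rw [dif_neg hf, dif_neg hex, zpow_zero]

end StepB

section Forcing

structure Ext {X Y : Type} (P : Pre I X) (Q : Pre I Y) where
  f : X → Y
  inj : Function.Injective f
  hL : ∀ i x, P.L i x → Q.L i (f x)
  hs : ∀ i n x, P.L i x → f (P.s i n x) = Q.s i n (f x)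

def Ext.id {X : Type} (P : Pre I X) : Ext P P :=
  ⟨fun x => x, fun _ _ h => h, fun _ _ h => h, fun _ _ _ _ => rfl⟩

def Ext.comp {X Y Z : Type} {P : Pre I X} {Q : Pre I Y} {R : Pre I Z} (g : Ext Q R) (f : Ext P Q) :
    Ext P R :=
  ⟨fun x => g.f (f.f x), fun _ _ h => f.inj (g.inj h), fun i x h => g.hL _ _ (f.hL i x h),
    fun i n x h => by rw [f.hs i n x h, g.hs _ _ _ (f.hL i x h)]⟩

noncomputable def one [Nonempty I] {X : Type} (P : Good1 S X) : Good1 S (WY (stepB P)) :=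
  stepA (stepB P)

noncomputable def oneExt [Nonempty I] {X : Type} (P : Good1 S X) : Ext P.toPre (one P).toPre where
  f x := WY.core (CB.old x)
  inj x y h := by
    injection h with h
    injection h
  hL i x h := trivial
  hs i n x h := by
    have h1 : (stepB P).L i (CB.old x) := trivial
    refine Eq.trans ?_ (WY_s_core_pos (stepB P) n h1).symm
    exact congrArg WY.core (st_L P h).symm

theorem one_L [Nonempty I] {X : Type} (P : Good1 S X) (i : I) (x : X) :
    (one P).L i ((oneExt P).f x) := trivial

def Cpl {X : Type} (P : Pre I X) (e : S.E) (y : X) : Prop :=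
  ∃ ψ : S.A e → X, ψ 1 = y ∧ ∀ g i, S.mem e i → P.L i (ψ g) ∧
    ∀ n, P.s i n (ψ g) = ψ (S.gen e i ^ n * g)

theorem Cpl.ext {X Y : Type} {P : Pre I X} {Q : Pre I Y} (f : Ext P Q) {e : S.E} {y : X}
    (h : Cpl P e y) : Cpl Q e (f.f y) := by
  obtain ⟨ψ, h1, h2⟩ := h
  refine ⟨fun g => f.f (ψ g), by simp only [h1], fun g i hi => ⟨f.hL _ _ (h2 g i hi).1, fun n => ?_⟩⟩
  change Q.s i n (f.f (ψ g)) = f.f (ψ _)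
  rw [← (h2 g i hi).2 n, f.hs _ _ _ (h2 g i hi).1]

theorem one_cpl [Nonempty I] {X : Type} (P : Good1 S X) {e : S.E} {x : X} (h : att P e x) :
    Cpl (one P).toPre e ((oneExt P).f x) := by
  refine ⟨fun g => WY.core (psi P e (P.kap e x) (g * P.phi e x)), ?_, fun g i hi =>
    ⟨trivial, fun n => ?_⟩⟩
  · change WY.core _ = WY.core _
    rw [one_mul, psi_old P h]
  · have h1 : (stepB P).L i (psi P e (P.kap e x) (g * P.phi e x)) := LC_psi P hi _ _
    refine (WY_s_core_pos (stepB P) n h1).trans ?_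
    refine congrArg WY.core ?_
    refine (st_psi P n hi _ _).trans ?_
    rw [mul_assoc]

def perm {X : Type} (P : Pre I X) (i : I) : Equiv.Perm X where
  toFun := P.s i 1
  invFun := P.s i (-1)
  left_inv x := by rw [P.s_add, neg_add_cancel, P.s_zero]
  right_inv x := by rw [P.s_add, add_neg_cancel, P.s_zero]

def rho {X : Type} (P : Pre I X) : FreeGroup I →* Equiv.Perm X := FreeGroup.lift (perm P)

theorem rho_of {X : Type} (P : Pre I X) (i : I) (x : X) : rho P (FreeGroup.of i) x = P.s i 1 x := by
  simp [rho, perm]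

theorem rho_of_inv {X : Type} (P : Pre I X) (i : I) (x : X) :
    rho P (FreeGroup.of i)⁻¹ x = P.s i (-1) x := by
  rw [map_inv, Equiv.Perm.inv_eq_iff_eq, rho_of, P.s_add, add_neg_cancel, P.s_zero]

def He (S : Sys I) (e : S.E) : Subgroup (FreeGroup I) :=
  Subgroup.closure {h | ∃ i, S.mem e i ∧ h = FreeGroup.of i}

def pie (S : Sys I) (e : S.E) : FreeGroup I →* S.A e := FreeGroup.lift (S.gen e)

theorem rho_cpl {X : Type} (P : Pre I X) {e : S.E} (ψ : S.A e → X)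
    (h : ∀ g i, S.mem e i → P.L i (ψ g) ∧ ∀ n, P.s i n (ψ g) = ψ (S.gen e i ^ n * g))
    {u : FreeGroup I} (hu : u ∈ He S e) : ∀ g, rho P u (ψ g) = ψ (pie S e u * g) := by
  refine Subgroup.closure_induction (p := fun u _ => ∀ g, rho P u (ψ g) = ψ (pie S e u * g))
    ?_ ?_ ?_ ?_ hu
  · rintro _ ⟨i, hi, rfl⟩ g
    rw [rho_of, (h g i hi).2]; simp [pie]
  · intro g; simp
  · intro x y _ _ hx hy g
    rw [map_mul, Equiv.Perm.mul_apply, hy, hx, map_mul, mul_assoc]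
  · intro x _ hx g
    rw [map_inv, Equiv.Perm.inv_eq_iff_eq, hx, map_inv, mul_inv_cancel_left]

def Path {X : Type} (P : Good1 S X) (h : FreeGroup I) (x y : X) : Prop :=
  ∀ (Y : Type) (Q : Good1 S Y) (f : Ext P.toPre Q.toPre), rho Q.toPre h (f.f x) = f.f y

theorem Path.ext {X Y : Type} {P : Good1 S X} {Q : Good1 S Y} (f : Ext P.toPre Q.toPre)
    {h : FreeGroup I} {x y : X} (hp : Path P h x y) : Path Q h (f.f x) (f.f y) :=
  fun Z R g => hp Z R (g.comp f)

theorem Path.one {X : Type} (P : Good1 S X) (x : X) : Path P 1 x x := fun _ _ _ => by simp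

theorem Path.mul {X : Type} {P : Good1 S X} {h k : FreeGroup I} {x y z : X}
    (h2 : Path P k y z) (h1 : Path P h x y) : Path P (k * h) x z := fun Z R g => by
  rw [map_mul, Equiv.Perm.mul_apply, h1, h2]

theorem Path.inv {X : Type} {P : Good1 S X} {h : FreeGroup I} {x y : X}
    (h1 : Path P h x y) : Path P h⁻¹ y x := fun Z R g => by
  rw [map_inv, Equiv.Perm.inv_eq_iff_eq, h1]

theorem Path.of {X : Type} {P : Good1 S X} {i : I} {x : X} (h : P.L i x) :
    Path P (FreeGroup.of i) x (P.s i 1 x) := fun Z R g => by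
  rw [rho_of, g.hs _ _ _ h]

theorem Path.of_inv {X : Type} {P : Good1 S X} {i : I} {x : X} (h : P.L i x) :
    Path P (FreeGroup.of i)⁻¹ x (P.s i (-1) x) := fun Z R g => by
  rw [rho_of_inv, g.hs _ _ _ h]

variable [Nonempty I]

theorem det (p : FreeGroup I) : ∀ (X : Type) (P : Good1 S X) (x : X),
    ∃ (Y : Type) (Q : Good1 S Y) (f : Ext P.toPre Q.toPre) (y : Y), Path Q p (f.f x) y := by
  induction p using FreeGroup.induction_on with
  | C1 => exact fun X P x => ⟨X, P, Ext.id _, x, Path.one _ _⟩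
  | of i => exact fun X P x => ⟨_, ArtinAux.one P, oneExt P, _, Path.of (one_L P i x)⟩
  | inv_of i _ => exact fun X P x => ⟨_, ArtinAux.one P, oneExt P, _, Path.of_inv (one_L P i x)⟩
  | mul a b ha hb =>
    intro X P x
    obtain ⟨Y, Q, f, y, h⟩ := hb X P x
    obtain ⟨Z, R, g, z, h'⟩ := ha Y Q y
    exact ⟨Z, R, g.comp f, z, h'.mul (h.ext g)⟩

def Kset (S : Sys I) : Subgroup (FreeGroup I) where
  carrier := {h | ∀ (X : Type) (P : Good1 S X) (x : X),
    ∃ (Y : Type) (Q : Good1 S Y) (f : Ext P.toPre Q.toPre), Path Q h (f.f x) (f.f x)}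
  one_mem' X P x := ⟨X, P, Ext.id _, Path.one _ _⟩
  mul_mem' {a b} ha hb X P x := by
    obtain ⟨Y, Q, f, h⟩ := hb X P x
    obtain ⟨Z, R, g, h'⟩ := ha Y Q (f.f x)
    exact ⟨Z, R, g.comp f, h'.mul (h.ext g)⟩
  inv_mem' {a} ha X P x := by
    obtain ⟨Y, Q, f, h⟩ := ha X P x
    exact ⟨Y, Q, f, h.inv⟩

instance Kset_normal (S : Sys I) : (Kset S).Normal where
  conj_mem h hh p X P x := by
    obtain ⟨Y, Q, f, y, h1⟩ := det p⁻¹ X P x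
    obtain ⟨Z, R, g, h2⟩ := hh Y Q y
    have h3 := h1.ext g
    refine ⟨Z, R, g.comp f, ?_⟩
    have h4 := h3.inv
    rw [inv_inv] at h4
    exact (h4.mul h2).mul h3

theorem rel_mem {e : S.E} {u : FreeGroup I} (hu : u ∈ He S e) (h1 : pie S e u = 1) : u ∈ Kset S := by
  intro X P x
  refine ⟨_, ArtinAux.one (ArtinAux.one P), (oneExt _).comp (oneExt P), ?_⟩
  have hatt : att (ArtinAux.one P) e ((oneExt P).f x) := by
    obtain ⟨i, hi⟩ := S.nonempty e
    exact ⟨i, hi, one_L P i x⟩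
  intro Z R g
  obtain ⟨ψ, h2, h3⟩ := (one_cpl _ hatt).ext g
  have := rho_cpl R.toPre ψ h3 hu 1
  rw [h1, one_mul, h2] at this
  exact this

theorem abstract_main {X : Type} (P : Good1 S X) (rels : Set (FreeGroup I))
    (hr : ∀ r ∈ rels, ∃ e, r ∈ He S e ∧ pie S e r = 1) {w : FreeGroup I}
    (hw : PresentedGroup.mk rels w = 1) {x y : X} (hp : Path P w x y) : x = y := by
  have h1 : Subgroup.normalClosure rels ≤ Kset S := by
    apply Subgroup.normalClosure_le_normal
    intro r h
    obtain ⟨e, h1, h2⟩ := hr r h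
    exact rel_mem h1 h2
  have h2 : w ∈ Kset S := h1 ((QuotientGroup.eq_one_iff w).1 hw)
  obtain ⟨Y, Q, f, h3⟩ := h2 X P x
  have h4 := h3 Y Q (Ext.id _)
  have h5 := hp Y Q f
  exact f.inj (h4.symm.trans h5)

end Forcing

end ArtinAux

namespace ArtinAux

section Concrete

open Matrix

abbrev SL := Matrix.SpecialLinearGroup (Fin 2) ℝ

def UU (t : ℝ) : SL := ⟨!![1, t; 0, 1], by simp [Matrix.det_fin_two]⟩
def VV (t : ℝ) : SL := ⟨!![1, 0; -t, 1], by simp [Matrix.det_fin_two]⟩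
def JJ : SL := ⟨!![0, 1; -1, 0], by simp [Matrix.det_fin_two]⟩

theorem UU_c (t : ℝ) : (UU t : Matrix (Fin 2) (Fin 2) ℝ) = !![1, t; 0, 1] := rfl
theorem VV_c (t : ℝ) : (VV t : Matrix (Fin 2) (Fin 2) ℝ) = !![1, 0; -t, 1] := rfl
theorem JJ_c : (JJ : Matrix (Fin 2) (Fin 2) ℝ) = !![0, 1; -1, 0] := rfl

theorem UU_mul (s t : ℝ) : UU s * UU t = UU (s + t) := by
  ext i j; fin_cases i <;> fin_cases j <;> simp [UU_c, Matrix.mul_apply, Fin.sum_univ_two, add_comm]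

theorem VV_mul (s t : ℝ) : VV s * VV t = VV (s + t) := by
  ext i j; fin_cases i <;> fin_cases j <;> simp [VV_c, Matrix.mul_apply, Fin.sum_univ_two, add_comm]

theorem UU_zero : UU 0 = 1 := by
  ext i j; fin_cases i <;> fin_cases j <;> simp [UU_c]

theorem VV_zero : VV 0 = 1 := by
  ext i j; fin_cases i <;> fin_cases j <;> simp [VV_c]

def UUh : Multiplicative ℝ →* SL where
  toFun t := UU t.toAdd
  map_one' := UU_zero
  map_mul' s t := (UU_mul _ _).symm

def VVh : Multiplicative ℝ →* SL where
  toFun t := VV t.toAdd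
  map_one' := VV_zero
  map_mul' s t := (VV_mul _ _).symm

theorem UU_zpow (t : ℝ) (n : ℤ) : UU t ^ n = UU (n * t) := by
  have := map_zpow UUh (Multiplicative.ofAdd t) n
  rw [← ofAdd_zsmul, zsmul_eq_mul] at this
  exact this.symm

theorem VV_zpow (t : ℝ) (n : ℤ) : VV t ^ n = VV (n * t) := by
  have := map_zpow VVh (Multiplicative.ofAdd t) n
  rw [← ofAdd_zsmul, zsmul_eq_mul] at this
  exact this.symm

theorem JUJ (t : ℝ) : JJ * UU t = VV t * JJ := by
  ext i j; fin_cases i <;> fin_cases j <;> simp [UU_c, VV_c, JJ_c, Matrix.mul_apply, Fin.sum_univ_two]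

theorem JVJ (t : ℝ) : JJ * VV t = UU t * JJ := by
  ext i j; fin_cases i <;> fin_cases j <;> simp [UU_c, VV_c, JJ_c, Matrix.mul_apply, Fin.sum_univ_two]

theorem alt_conj {H σ : Type} [Group H] (f : σ → H) (J : H) {i j : σ}
    (h1 : J * f i = f j * J) (h2 : J * f j = f i * J) (m : ℕ) :
    J * FreeGroup.lift f (altWord i j m) = FreeGroup.lift f (altWord j i m) * J := by
  induction m generalizing i j with
  | zero => simp [altWord]
  | succ m ih =>
    simp only [altWord, map_mul, FreeGroup.lift_apply_of]
    rw [← mul_assoc, h1, mul_assoc, ih h2 h1, mul_assoc]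

theorem alt_pow {H σ : Type} [Group H] (f : σ → H) (J : H) {i j : σ}
    (h1 : J * f i = f j * J) (h2 : J * f j = f i * J) (m : ℕ) :
    FreeGroup.lift f (altWord i j m) * J ^ m = (f i * J) ^ m := by
  induction m with
  | zero => simp [altWord]
  | succ m ih =>
    rw [pow_succ' (f i * J), ← ih]
    simp only [altWord, map_mul, FreeGroup.lift_apply_of]
    rw [mul_assoc (f i) J, ← mul_assoc J, alt_conj f J h1 h2 m, pow_succ' J]
    simp only [mul_assoc]

theorem alt_eq {H σ : Type} [Group H] (f : σ → H) (J : H) {i j : σ}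
    (h1 : J * f i = f j * J) (h2 : J * f j = f i * J) (m : ℕ) (hc : Commute J ((f i * J) ^ m)) :
    FreeGroup.lift f (altWord i j m) = FreeGroup.lift f (altWord j i m) := by
  have h3 := alt_conj f J h1 h2 m
  have h4 : FreeGroup.lift f (altWord i j m) = (f i * J) ^ m * (J ^ m)⁻¹ := by
    rw [← alt_pow f J h1 h2 m, mul_inv_cancel_right]
  have h5 : Commute J (FreeGroup.lift f (altWord i j m)) := by
    rw [h4]
    exact hc.mul_right ((Commute.refl J).pow_right m).inv_right
  rw [h5.eq] at h3
  exact mul_right_cancel h3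

theorem sinpow (θ : ℝ) (k : ℕ) :
    Real.sin θ • (!![2 * Real.cos θ, 1; -1, 0] : Matrix (Fin 2) (Fin 2) ℝ) ^ (k + 1) =
      Real.sin ((k + 1) * θ) • !![2 * Real.cos θ, 1; -1, 0] -
        Real.sin (k * θ) • (1 : Matrix (Fin 2) (Fin 2) ℝ) := by
  induction k with
  | zero => simp
  | succ k ih =>
    rw [pow_succ, ← smul_mul_assoc, ih]
    have h1 : ((k + 1 : ℕ) : ℝ) * θ = (k + 1) * θ := by push_cast; ring
    have h2 : (((k + 1 : ℕ) : ℝ) + 1) * θ = (k + 1) * θ + θ := by push_cast; ring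
    have h3 : (k : ℝ) * θ = (k + 1) * θ - θ := by ring
    rw [h1, h2, h3, Real.sin_add, Real.sin_sub]
    ext i j; fin_cases i <;> fin_cases j <;> simp [Matrix.mul_apply, Fin.sum_univ_two] <;> ring

theorem commJ (m : ℕ) (hm : 4 ≤ m) :
    Commute JJ ((UU (-(2 * Real.cos (Real.pi / m))) * JJ) ^ m) := by
  obtain ⟨k, rfl⟩ : ∃ k, m = k + 1 := ⟨m - 1, by omega⟩
  set θ := Real.pi / ((k + 1 : ℕ) : ℝ) with hθ
  have hpos : (0 : ℝ) < ((k + 1 : ℕ) : ℝ) := by positivity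
  have h1 : ((k : ℝ) + 1) * θ = Real.pi := by
    rw [hθ]; push_cast; field_simp
  have hs : Real.sin θ ≠ 0 := by
    apply ne_of_gt
    apply Real.sin_pos_of_pos_of_lt_pi
    · exact div_pos Real.pi_pos hpos
    · apply div_lt_self Real.pi_pos
      exact_mod_cast (by omega : 1 < k + 1)
  have hX : ((UU (-(2 * Real.cos θ)) * JJ : SL) : Matrix (Fin 2) (Fin 2) ℝ) =
      !![2 * Real.cos θ, 1; -1, 0] := by
    ext i j; fin_cases i <;> fin_cases j <;> simp [UU_c, JJ_c, Matrix.mul_apply, Fin.sum_univ_two]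
  have h2 := sinpow θ k
  rw [h1, Real.sin_pi, zero_smul, zero_sub, ← neg_smul] at h2
  have h3 : (!![2 * Real.cos θ, 1; -1, 0] : Matrix (Fin 2) (Fin 2) ℝ) ^ (k + 1) =
      ((Real.sin θ)⁻¹ * -Real.sin (k * θ)) • (1 : Matrix (Fin 2) (Fin 2) ℝ) := by
    rw [mul_smul, ← h2, smul_smul, inv_mul_cancel₀ hs, one_smul]
  apply Subtype.ext
  rw [Matrix.SpecialLinearGroup.coe_mul, Matrix.SpecialLinearGroup.coe_mul,
    Matrix.SpecialLinearGroup.coe_pow, hX, h3]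
  simp

theorem exists_c (N : ℕ∞) (hN : 4 ≤ N) : ∃ c : ℝ, c ≠ 0 ∧ ∀ m : ℕ, N = m →
    Commute JJ ((UU c * JJ) ^ m) := by
  by_cases h : ∃ m : ℕ, N = m
  · obtain ⟨m, rfl⟩ := h
    have hm : 4 ≤ m := by exact_mod_cast hN
    refine ⟨-(2 * Real.cos (Real.pi / m)), ?_, ?_⟩
    · have : 0 < Real.cos (Real.pi / m) := by
        have hm' : (4 : ℝ) ≤ m := by exact_mod_cast hm
        apply Real.cos_pos_of_mem_Ioo
        constructor
        · have : 0 < Real.pi / m := div_pos Real.pi_pos (by linarith)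
          linarith [Real.pi_pos]
        · apply div_lt_div_of_pos_left Real.pi_pos (by norm_num) (by linarith)
      intro h
      linarith
    · intro m' hm'
      have : m = m' := by exact_mod_cast hm'
      subst this
      exact commJ m hm
  · exact ⟨1, one_ne_zero, fun m hm => absurd ⟨m, hm⟩ h⟩

variable (n : ℕ) (M : Fin n → Fin n → ℕ∞)

def relsE (e : {e : Sym2 (Fin n) // ¬ e.IsDiag}) : Set (FreeGroup (Fin n)) :=
  {r | (∃ i j : Fin n, i ≠ j ∧ s(i, j) = e.1 ∧ ∃ m : ℕ, M i j = (m : ℕ∞) ∧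
      r = altWord i j m * (altWord j i m)⁻¹) ∨ ∃ k, k ∉ e.1 ∧ r = FreeGroup.of k}

theorem rep (hsym : ∀ i j, M i j = M j i) (hM : ∀ i j, i ≠ j → 4 ≤ M i j)
    {i j : Fin n} (hij : i ≠ j) (e : {e : Sym2 (Fin n) // ¬ e.IsDiag}) (he : e.1 = s(i, j)) :
    ∃ (c : ℝ) (f : PresentedGroup (relsE n M e) →* SL), c ≠ 0 ∧
      f (PresentedGroup.of i) = UU c ∧ f (PresentedGroup.of j) = VV c := by
  obtain ⟨c, hc, hcm⟩ := exists_c (M i j) (hM i j hij)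
  let f : Fin n → SL := fun k => if k = i then UU c else if k = j then VV c else 1
  have fi : f i = UU c := by simp [f]
  have fj : f j = VV c := by simp [f, hij.symm]
  have key : ∀ m : ℕ, M i j = m →
      FreeGroup.lift f (altWord i j m) = FreeGroup.lift f (altWord j i m) := by
    intro m hm
    apply alt_eq f JJ
    · rw [fi, fj, JUJ]
    · rw [fi, fj, JVJ]
    · rw [fi]; exact hcm m hm
  have hrel : ∀ r ∈ relsE n M e, FreeGroup.lift f r = 1 := by
    rintro r (⟨a, b, hab, hs, m, hm, rfl⟩ | ⟨k, hk, rfl⟩)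
    · rw [map_mul, map_inv, mul_inv_eq_one]
      rw [he, Sym2.eq_iff] at hs
      rcases hs with ⟨rfl, rfl⟩ | ⟨rfl, rfl⟩
      · exact key m hm
      · exact (key m (by rw [hsym]; exact hm)).symm
    · rw [he, Sym2.mem_iff, not_or] at hk
      simp [f, hk.1, hk.2]
  refine ⟨c, PresentedGroup.toGroup hrel, hc, ?_, ?_⟩
  · rw [PresentedGroup.toGroup.of, fi]
  · rw [PresentedGroup.toGroup.of, fj]

def artSys (hsym : ∀ i j, M i j = M j i) (hM : ∀ i j, i ≠ j → 4 ≤ M i j) : Sys (Fin n) where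
  E := {e : Sym2 (Fin n) // ¬ e.IsDiag}
  A e := PresentedGroup (relsE n M e)
  grp e := inferInstance
  mem e i := i ∈ e.1
  gen e i := PresentedGroup.of i
  edge_ex i j hij := ⟨⟨s(i, j), by simpa using hij⟩, by simp, by simp⟩
  edge_uniq {i j e e'} hij h1 h2 h3 h4 := by
    apply Subtype.ext
    rw [((Sym2.mem_and_mem_iff hij).1 ⟨h1, h2⟩), ((Sym2.mem_and_mem_iff hij).1 ⟨h3, h4⟩)]
  two {e i j k} h1 h2 hij h3 := by
    rw [((Sym2.mem_and_mem_iff hij).1 ⟨h1, h2⟩)] at h3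
    simpa using h3
  nonempty e := by
    obtain ⟨e, he⟩ := e
    induction e with
    | h i j => exact ⟨i, by simp⟩
  g1 {e i m} h1 h2 := by
    obtain ⟨j, hj⟩ := Sym2.mem_iff_exists.1 h1
    have hij : i ≠ j := by
      rintro rfl; exact e.2 (by rw [hj]; simp)
    obtain ⟨c, f, hc, hi, hj⟩ := rep n M hsym hM hij e hj
    have := congrArg f h2
    rw [map_zpow, hi, UU_zpow, map_one] at this
    have := congrArg (fun g : SL => g.1 0 1) this
    simpa [UU_c, hc] using this
  g2 {e i j m k} h1 h2 hij h3 := by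
    obtain ⟨c, f, hc, hi, hj⟩ := rep n M hsym hM hij e ((Sym2.mem_and_mem_iff hij).1 ⟨h1, h2⟩)
    have := congrArg f h3
    rw [map_zpow, map_zpow, hi, hj, UU_zpow, VV_zpow] at this
    have := congrArg (fun g : SL => g.1 0 1) this
    simpa [UU_c, VV_c, hc] using this
  g4 {e i j p q r s} h1 h2 hij h3 := by
    obtain ⟨c, f, hc, hi, hj⟩ := rep n M hsym hM hij e ((Sym2.mem_and_mem_iff hij).1 ⟨h1, h2⟩)
    have := congrArg f h3
    simp only [map_mul, map_zpow, hi, hj, UU_zpow, VV_zpow] at this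
    have := congrArg (fun g : SL => g.1 0 0) this
    simpa [UU_c, VV_c, hc, Matrix.mul_apply, Fin.sum_univ_two] using this

end Concrete

section Words

open FreeGroup

variable {σ : Type} [DecidableEq σ]

def syllL (L : List (σ × Bool)) : ℕ := ((L.map Prod.fst).destutter (· ≠ ·)).length

theorem syllL_mono {L L' : List (σ × Bool)} (h : L.Sublist L') : syllL L ≤ syllL L' :=
  List.IsChain.length_le_length_destutter_ne
    (((L.map Prod.fst).destutter_sublist (R := (· ≠ ·))).trans (h.map _))
    (List.isChain_destutter _ _)

theorem syllL_append (A B : List (σ × Bool)) : syllL (A ++ B) ≤ syllL A + syllL B := by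
  have h1 := ((A ++ B).map Prod.fst).destutter_sublist (R := (· ≠ ·))
  have h2 := ((A ++ B).map Prod.fst).isChain_destutter (R := (· ≠ ·))
  rw [List.map_append] at h1 h2
  obtain ⟨l1, l2, h3, h4, h5⟩ := List.sublist_append_iff.1 h1
  unfold syllL
  rw [h3] at h2
  rw [List.map_append, h3, List.length_append]
  have h6 := List.isChain_append.1 h2
  exact Nat.add_le_add (List.IsChain.length_le_length_destutter_ne h4 h6.1)
    (List.IsChain.length_le_length_destutter_ne h5 h6.2.1)

theorem syllL_const {i : σ} {L : List (σ × Bool)} (h : ∀ a ∈ L, a.1 = i) : syllL L ≤ 1 := by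
  have h1 := (L.map Prod.fst).destutter_sublist (R := (· ≠ ·))
  have h2 := (L.map Prod.fst).isChain_destutter (R := (· ≠ ·))
  have h3 : ∀ b ∈ (L.map Prod.fst).destutter (· ≠ ·), b = i := by
    intro b hb
    have := h1.subset hb
    rw [List.mem_map] at this
    obtain ⟨a, ha, rfl⟩ := this
    exact h a ha
  unfold syllL
  generalize (L.map Prod.fst).destutter (· ≠ ·) = D at *
  rcases D with _ | ⟨b, _ | ⟨c, D⟩⟩
  · simp
  · simp
  · rw [List.isChain_cons_cons] at h2
    exact absurd ((h3 b (by simp)).trans (h3 c (by simp)).symm) h2.1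

theorem glast {τ : Type} (L : List τ) {z y : τ} (h : (L ++ [z]).getLast? = some y) : z = y := by
  simpa using h

theorem tw {L : List (σ × Bool)} (h : IsReduced L) : (FreeGroup.mk L).toWord = L := by
  rw [toWord_mk, h.reduce_eq]

theorem red_infix {L L' : List (σ × Bool)} (h : IsReduced L') (hi : L <:+: L') : IsReduced L :=
  List.IsChain.infix h hi

theorem toWord_append {a b : FreeGroup σ}
    (h : ∀ x ∈ a.toWord.getLast?, ∀ y ∈ b.toWord.head?, x.1 ≠ y.1) :
    (a * b).toWord = a.toWord ++ b.toWord := by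
  rw [toWord_mul]
  apply IsReduced.reduce_eq
  refine List.isChain_append.2 ⟨isReduced_toWord, isReduced_toWord, fun x hx y hy hxy => ?_⟩
  exact absurd hxy (h x hx y hy)

theorem of_inv_letters {p : σ → Prop} {a : FreeGroup σ} (h : ∀ x ∈ a.toWord, p x.1) :
    ∀ x ∈ a⁻¹.toWord, p x.1 := by
  intro x hx
  rw [toWord_inv, invRev, List.mem_reverse, List.mem_map] at hx
  obtain ⟨y, hy, rfl⟩ := hx
  exact h y hy

theorem mul_letters {p : σ → Prop} {a b : FreeGroup σ} (h : ∀ x ∈ a.toWord, p x.1)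
    (h' : ∀ x ∈ b.toWord, p x.1) : ∀ x ∈ (a * b).toWord, p x.1 := by
  intro x hx
  have := (toWord_mul_sublist a b).subset hx
  rcases List.mem_append.1 this with h1 | h1
  · exact h x h1
  · exact h' x h1

theorem zpow_letters (i : σ) (k : ℤ) : ∀ x ∈ (of i ^ k).toWord, x.1 = i := by
  obtain ⟨n, rfl | rfl⟩ := k.eq_nat_or_neg
  · rw [zpow_natCast, toWord_of_pow]
    intro x hx
    rw [List.eq_of_mem_replicate hx]
  · rw [zpow_neg, zpow_natCast]
    apply of_inv_letters (p := fun j => j = i)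
    rw [toWord_of_pow]
    intro x hx
    rw [List.eq_of_mem_replicate hx]

theorem of_zpow_ne_one (i : σ) {k : ℤ} (hk : k ≠ 0) : of i ^ k ≠ 1 := by
  intro h
  have h1 := congrArg (FreeGroup.lift (fun _ : σ => (Multiplicative.ofAdd (1 : ℤ)))) h
  rw [map_zpow, lift_apply_of, (FreeGroup.lift _).map_one, ← ofAdd_zsmul] at h1
  have h2 := congrArg Multiplicative.toAdd h1
  simp at h2
  exact hk h2

theorem toWord_two {i j : σ} (hij : i ≠ j) (p q : ℤ) :
    (of i ^ p * of j ^ q).toWord = (of i ^ p).toWord ++ (of j ^ q).toWord := by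
  apply toWord_append
  intro x hx y hy
  rw [zpow_letters i p x (List.mem_of_getLast? hx), zpow_letters j q y (List.mem_of_head? hy)]
  exact hij

theorem toWord_three {i j k : σ} (hij : i ≠ j) (hjk : j ≠ k) (p : ℤ) {q : ℤ} (hq : q ≠ 0) (r : ℤ) :
    (of i ^ p * (of j ^ q * of k ^ r)).toWord =
      (of i ^ p).toWord ++ ((of j ^ q).toWord ++ (of k ^ r).toWord) := by
  rw [← toWord_two hjk]
  apply toWord_append
  intro x hx y hy
  rw [zpow_letters i p x (List.mem_of_getLast? hx)]
  rw [toWord_two hjk] at hy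
  have h1 : (of j ^ q).toWord ≠ [] := by
    rw [Ne, toWord_eq_nil_iff]; exact of_zpow_ne_one j hq
  obtain ⟨a, l, h2⟩ := List.exists_cons_of_ne_nil h1
  have h3 : y = a := by
    rw [h2] at hy; simpa using hy.symm
  rw [h3, zpow_letters j q a (by rw [h2]; simp)]
  exact hij

theorem syllL_three (i j k : σ) (p q r : ℤ) :
    syllL (of i ^ p * (of j ^ q * of k ^ r)).toWord ≤ 3 := by
  have h1 := syllL_mono (toWord_mul_sublist (of i ^ p) (of j ^ q * of k ^ r))
  have h2 := syllL_append (of i ^ p).toWord (of j ^ q * of k ^ r).toWord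
  have h3 := syllL_mono (toWord_mul_sublist (of j ^ q) (of k ^ r))
  have h4 := syllL_append (of j ^ q).toWord (of k ^ r).toWord
  have h5 := syllL_const (zpow_letters i p)
  have h6 := syllL_const (zpow_letters j q)
  have h7 := syllL_const (zpow_letters k r)
  omega

theorem mk_conj (x : σ × Bool) (L : List (σ × Bool)) :
    FreeGroup.mk (x :: (L ++ [(x.1, !x.2)])) = FreeGroup.mk [x] * FreeGroup.mk L * (FreeGroup.mk [x])⁻¹ := by
  simp [FreeGroup.invRev]

theorem mk_cancel (x : σ × Bool) (A B : List (σ × Bool)) :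
    FreeGroup.mk ((A ++ [x]) ++ (x.1, !x.2) :: B) = FreeGroup.mk (A ++ B) := by
  have : FreeGroup.mk ((A ++ [x]) ++ (x.1, !x.2) :: B) =
    FreeGroup.mk A * FreeGroup.mk [x] * ((FreeGroup.mk [x])⁻¹ * FreeGroup.mk B) := by
    simp [FreeGroup.invRev]
  rw [this, ← mul_assoc, mul_inv_cancel_right, mul_mk]

theorem cyc {A : Type} [Group A] (φ : FreeGroup σ →* A) (W : List (σ × Bool)) (p : σ → Prop)
    (hbad : ∀ V Q : List (σ × Bool), V <:+: W → IsReduced (V ++ Q) → V ++ Q ≠ [] →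
      (∀ x y, (V ++ Q).head? = some x → (V ++ Q).getLast? = some y → x ≠ (y.1, !y.2)) →
      (∀ a ∈ V ++ Q, p a.1) → syllL Q ≤ 3 → φ (FreeGroup.mk (V ++ Q)) ≠ 1) (N : ℕ) :
    ∀ V Q : List (σ × Bool), V.length + Q.length ≤ N → V <:+: W → IsReduced V → IsReduced Q →
      (∀ a ∈ V ++ Q, p a.1) → syllL Q ≤ 3 → φ (FreeGroup.mk (V ++ Q)) = 1 →
      FreeGroup.mk (V ++ Q) = 1 := by
  induction N with
  | zero =>
    intro V Q h _ _ _ _ _ _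
    have h1 : V = [] := List.length_eq_zero_iff.1 (by omega)
    have h2 : Q = [] := List.length_eq_zero_iff.1 (by omega)
    subst h1 h2; rfl
  | succ N ih =>
    intro V Q hN hV hVr hQr hp hs h1
    have conj : ∀ x L, (φ (FreeGroup.mk L) = 1 → FreeGroup.mk L = 1) →
        φ (FreeGroup.mk (x :: (L ++ [(x.1, !x.2)]))) = 1 →
        FreeGroup.mk (x :: (L ++ [(x.1, !x.2)])) = 1 := by
      intro x L h h'
      rw [mk_conj] at h' ⊢
      rw [_root_.map_mul, _root_.map_mul, _root_.map_inv, mul_inv_eq_one, mul_eq_left] at h'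
      rw [h h', mul_one, mul_inv_cancel]
    by_cases hr : IsReduced (V ++ Q)
    · by_cases hnil : V ++ Q = []
      · rw [hnil]; rfl
      by_cases hc : ∀ x y, (V ++ Q).head? = some x → (V ++ Q).getLast? = some y → x ≠ (y.1, !y.2)
      · exact absurd h1 (hbad V Q hV hr hnil hc hp hs)
      push Not at hc
      obtain ⟨x, y, hx, hy, hxy⟩ := hc
      have hyx : y = (x.1, !x.2) := by rw [hxy]; simp
      have hne : x ≠ y := by
        rw [hyx]; intro h
        have := congrArg Prod.snd h
        simp at this
      clear hxy
      rcases V with _ | ⟨v, V⟩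
      · rw [List.nil_append] at hx hy hp h1 ⊢
        obtain ⟨Q', rfl⟩ := List.head?_eq_some_iff.1 hx
        rcases List.eq_nil_or_concat Q' with rfl | ⟨Q1, z, rfl⟩
        · simp at hy; exact absurd hy hne
        · rw [List.concat_eq_append] at *
          have hz : z = y := glast (x :: Q1) hy
          subst hz; subst hyx
          refine conj x Q1 (fun h => ?_) h1
          refine ih [] Q1 (by simp at hN ⊢; omega) hV hVr (red_infix hQr ⟨[x], [(x.1, !x.2)], by simp⟩) ?_ ?_ h
          · intro a ha; apply hp; simp at ha ⊢; tauto
          · refine (syllL_mono ?_).trans hs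
            exact (List.sublist_append_left _ _).trans (List.sublist_cons_self _ _)
      · have hv : v = x := by simpa using hx
        subst hv
        rcases List.eq_nil_or_concat Q with rfl | ⟨Q1, z, rfl⟩
        · rw [List.append_nil] at hx hy hp h1 ⊢
          rcases List.eq_nil_or_concat V with rfl | ⟨V1, z, rfl⟩
          · simp at hy; exact absurd hy hne
          · rw [List.concat_eq_append] at *
            have hz : z = y := glast (v :: V1) hy
            subst hz; subst hyx
            refine conj v V1 (fun h => ?_) h1
            have hi : V1 <:+: v :: (V1 ++ [(v.1, !v.2)]) := ⟨[v], [(v.1, !v.2)], by simp⟩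
            have := ih V1 [] (by simp at hN ⊢; omega) (hi.trans hV) (red_infix hVr hi) hQr
            rw [List.append_nil] at this
            exact this (fun a ha => hp a (hi.subset ha)) hs h
        · rw [List.concat_eq_append] at *
          have hz : z = y := by
            rw [← List.append_assoc] at hy
            exact glast _ hy
          subst hz; subst hyx
          rw [List.cons_append, ← List.append_assoc] at h1 ⊢
          refine conj v (V ++ Q1) (fun h => ?_) h1
          have hi : V <:+: v :: V := ⟨[v], [], by simp⟩
          refine ih V Q1 (by simp at hN ⊢; omega) (hi.trans hV) (red_infix hVr hi)
            (red_infix hQr ⟨[], [(v.1, !v.2)], by simp⟩) ?_ ?_ h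
          · intro a ha; apply hp; simp at ha ⊢; tauto
          · refine (syllL_mono ?_).trans hs
            exact (List.sublist_append_left _ _)
    · have hex : ∃ x ∈ V.getLast?, ∃ y ∈ Q.head?, ¬ (x.1 = y.1 → x.2 = y.2) := by
        by_contra hcon
        push Not at hcon
        exact hr (List.isChain_append.2 ⟨hVr, hQr, hcon⟩)
      obtain ⟨x, hx, y, hy, hxy⟩ := hex
      push Not at hxy
      have hyx : y = (x.1, !x.2) := by
        apply Prod.ext
        · exact hxy.1.symm
        · simpa using (Bool.eq_not_of_ne hxy.2.symm)
      subst hyx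
      obtain ⟨V1, rfl⟩ := List.getLast?_eq_some_iff.1 hx
      obtain ⟨Q1, rfl⟩ := List.head?_eq_some_iff.1 hy
      rw [mk_cancel] at h1 ⊢
      have hi : V1 <:+: V1 ++ [x] := ⟨[], [x], by simp⟩
      refine ih V1 Q1 (by simp at hN ⊢; omega) (hi.trans hV) (red_infix hVr hi)
            (red_infix hQr ⟨[(x.1, !x.2)], [], by simp⟩) ?_ ?_ h1
      · intro a ha; apply hp; simp at ha ⊢; tauto
      · exact (syllL_mono (List.sublist_cons_self _ _)).trans hs

end Words

section Final

variable {n : ℕ} {M : Fin n → Fin n → ℕ∞}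

abbrev Ed (n : ℕ) := {e : Sym2 (Fin n) // ¬ e.IsDiag}

abbrev FG (n : ℕ) := FreeGroup (Fin n)

def Hc (e : Ed n) : Subgroup (FG n) :=
  Subgroup.closure {h | ∃ i, i ∈ e.1 ∧ h = FreeGroup.of i}

theorem Hc_of {e : Ed n} {i : Fin n} (h : i ∈ e.1) : FreeGroup.of i ∈ Hc e :=
  Subgroup.subset_closure ⟨i, h, rfl⟩

theorem Hc_letters {e : Ed n} {h : FG n} (hh : h ∈ Hc e) : ∀ a ∈ h.toWord, a.1 ∈ e.1 := by
  induction hh using Subgroup.closure_induction with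
  | mem x hx =>
    obtain ⟨i, hi, rfl⟩ := hx
    intro a ha
    rw [FreeGroup.toWord_of, List.mem_singleton] at ha
    rw [ha]; exact hi
  | one => simp
  | mul x y _ _ hx hy => exact mul_letters (p := fun i => i ∈ e.1) hx hy
  | inv x _ hx => exact of_inv_letters (p := fun i => i ∈ e.1) hx

theorem mk_cons_eq (a : Fin n × Bool) (L : List (Fin n × Bool)) :
    FreeGroup.mk (a :: L) =
      (bif a.2 then FreeGroup.of a.1 else (FreeGroup.of a.1)⁻¹) * FreeGroup.mk L := by
  obtain ⟨i, b⟩ := a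
  cases b
  · show _ = (FreeGroup.of i)⁻¹ * _
    rw [FreeGroup.of, FreeGroup.inv_mk, FreeGroup.mul_mk]; rfl
  · show _ = (FreeGroup.of i) * _
    rw [FreeGroup.of, FreeGroup.mul_mk]; rfl

theorem Hc_mk {e : Ed n} {L : List (Fin n × Bool)} (h : ∀ a ∈ L, a.1 ∈ e.1) :
    FreeGroup.mk L ∈ Hc e := by
  induction L with
  | nil => exact one_mem (Hc e)
  | cons a L ih =>
    rw [mk_cons_eq]
    refine mul_mem ?_ (ih fun b hb => h b (List.mem_cons_of_mem _ hb))
    have := Hc_of (h a (by simp))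
    cases a.2
    · exact inv_mem this
    · exact this

theorem alt_lift {σ τ : Type} {rels : Set (FreeGroup τ)} (f : σ → PresentedGroup rels) {a b : σ}
    {a' b' : τ} (ha : f a = PresentedGroup.of a') (hb : f b = PresentedGroup.of b') (m : ℕ) :
    FreeGroup.lift f (altWord a b m) = PresentedGroup.mk rels (altWord a' b' m) := by
  induction m generalizing a b a' b' with
  | zero => simp [altWord]
  | succ m ih =>
    simp only [altWord, map_mul, FreeGroup.lift_apply_of]
    rw [ih hb ha, ha]; rfl

theorem bad (hsym : ∀ i j, M i j = M j i) {w : FG n} (hred : ArtinReduced n M w) (e : Ed n)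
    (V Q : List (Fin n × Bool)) (hV : V <:+: w.toWord) (hr : FreeGroup.IsReduced (V ++ Q))
    (hne : V ++ Q ≠ [])
    (hc : ∀ x y, (V ++ Q).head? = some x → (V ++ Q).getLast? = some y → x ≠ (y.1, !y.2))
    (hl : ∀ a ∈ V ++ Q, a.1 ∈ e.1) (hs : syllL Q ≤ 3) :
    PresentedGroup.mk (relsE n M e) (FreeGroup.mk (V ++ Q)) ≠ 1 := by
  intro h1
  obtain ⟨i, j, hij, he⟩ : ∃ i j, i ≠ j ∧ e.1 = s(i, j) := by
    obtain ⟨e, he⟩ := e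
    induction e with
    | h i j => exact ⟨i, j, by simpa using he, rfl⟩
  have hmk : FreeGroup.mk (V ++ Q) ∈ Hc e := Hc_mk hl
  have hmk1 : FreeGroup.mk (V ++ Q) ≠ 1 := by
    intro h
    have := congrArg FreeGroup.toWord h
    rw [tw hr, FreeGroup.toWord_one] at this
    exact hne this
  by_cases htop : M i j = ⊤
  · let f : Fin n → FG n := fun k => if k ∈ e.1 then FreeGroup.of k else 1
    have hrel : ∀ r ∈ relsE n M e, FreeGroup.lift f r = 1 := by
      rintro r (⟨a, b, hab, hs, m, hm, rfl⟩ | ⟨k, hk, rfl⟩)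
      · exfalso
        rw [he, Sym2.eq_iff] at hs
        rcases hs with ⟨rfl, rfl⟩ | ⟨rfl, rfl⟩
        · rw [hm] at htop; exact ENat.coe_ne_top m htop
        · rw [hsym, hm] at htop; exact ENat.coe_ne_top m htop
      · rw [FreeGroup.lift_apply_of]; exact if_neg hk
    have heq : Set.EqOn ((PresentedGroup.toGroup hrel).comp (PresentedGroup.mk (relsE n M e)))
        (MonoidHom.id _) (Hc e) := by
      apply MonoidHom.eqOn_closure
      rintro _ ⟨k, hk, rfl⟩
      show PresentedGroup.toGroup hrel (PresentedGroup.of k) = FreeGroup.of k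
      rw [PresentedGroup.toGroup.of]
      exact if_pos hk
    have h2 := heq hmk
    rw [MonoidHom.comp_apply, h1, map_one] at h2
    exact hmk1 h2.symm
  · obtain ⟨m, hm⟩ := ENat.ne_top_iff_exists.1 htop
    let β : Fin n → Bool := fun k => decide (k = j)
    have hβ : ∀ k ∈ e.1, ∀ l ∈ e.1, β k = β l → k = l := by
      intro k hk l hl h
      rw [he, Sym2.mem_iff] at hk hl
      rcases hk with rfl | rfl <;> rcases hl with rfl | rfl <;> simp_all [β]
    let L' : List (Bool × Bool) := (V ++ Q).map (fun a => (β a.1, a.2))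
    have hr' : FreeGroup.IsReduced L' := by
      show List.IsChain _ _
      rw [List.isChain_map]
      refine List.IsChain.imp_of_mem_imp ?_ hr
      intro a b ha hb hab h
      exact hab (hβ _ (hl a ha) _ (hl b hb) h)
    have hr2 : FreeGroup.mk L' = FreeGroup.map β (FreeGroup.mk (V ++ Q)) := by
      rw [FreeGroup.map.mk]
    have hback : Set.EqOn ((FreeGroup.map (fun b => if b then j else i)).comp (FreeGroup.map β))
        (MonoidHom.id _) (Hc e) := by
      apply MonoidHom.eqOn_closure
      rintro _ ⟨k, hk, rfl⟩
      rw [he, Sym2.mem_iff] at hk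
      rcases hk with rfl | rfl <;> simp [β, hij]
    have hb := hback hmk
    rw [MonoidHom.comp_apply, ← hr2] at hb
    let f : Fin n → PresentedGroup
      ({ altWord false true m * (altWord true false m)⁻¹ } : Set (FreeGroup Bool)) :=
      fun k => if k = i then PresentedGroup.of false else if k = j then PresentedGroup.of true else 1
    have fi : f i = PresentedGroup.of false := by simp [f]
    have fj : f j = PresentedGroup.of true := by simp [f, hij.symm]
    have key : FreeGroup.lift f (altWord i j m) = FreeGroup.lift f (altWord j i m) := by
      rw [alt_lift f fi fj, alt_lift f fj fi, ← mul_inv_eq_one, ← map_inv, ← map_mul]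
      exact PresentedGroup.one_of_mem (by simp)
    have hrel : ∀ r ∈ relsE n M e, FreeGroup.lift f r = 1 := by
      rintro r (⟨a, b, hab, hs, m', hm', rfl⟩ | ⟨k, hk, rfl⟩)
      · rw [map_mul, map_inv, mul_inv_eq_one]
        rw [he, Sym2.eq_iff] at hs
        rcases hs with ⟨rfl, rfl⟩ | ⟨rfl, rfl⟩
        · have : m = m' := by rw [← hm] at hm'; exact_mod_cast hm'
          subst this; exact key
        · have : m = m' := by rw [hsym, ← hm] at hm'; exact_mod_cast hm'
          subst this; exact key.symm
      · rw [he, Sym2.mem_iff, not_or] at hk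
        simp [f, hk.1, hk.2]
    have hag : Set.EqOn ((PresentedGroup.toGroup hrel).comp (PresentedGroup.mk (relsE n M e)))
        ((twoGenArtinMk m).comp (FreeGroup.map β)) (Hc e) := by
      apply MonoidHom.eqOn_closure
      rintro _ ⟨k, hk, rfl⟩
      show PresentedGroup.toGroup hrel (PresentedGroup.of k) = twoGenArtinMk m (FreeGroup.map β _)
      rw [PresentedGroup.toGroup.of, FreeGroup.map.of]
      rw [he, Sym2.mem_iff] at hk
      rcases hk with rfl | rfl
      · have : β k = false := by simp [β, hij]
        rw [fi, this]; rfl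
      · have : β k = true := by simp [β]
        rw [fj, this]; rfl
    have h2 := hag hmk
    rw [MonoidHom.comp_apply, h1, map_one, MonoidHom.comp_apply, ← hr2] at h2
    have hVr := red_infix hr ⟨[], Q, by simp⟩ (L := V)
    have hQr := red_infix hr ⟨V, [], by simp⟩ (L := Q)
    refine hred ⟨i, j, m, hij, hm.symm, FreeGroup.mk L', ?_, ?_, h2.symm, FreeGroup.mk V,
      FreeGroup.mk Q, ?_, ?_, ?_⟩
    · intro h
      rw [h, map_one] at hb
      exact hmk1 hb.symm
    · intro x y hx hy hxy
      rw [tw hr', List.head?_map, Option.map_eq_some_iff] at hx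
      rw [tw hr', List.getLast?_map, Option.map_eq_some_iff] at hy
      obtain ⟨a, ha, rfl⟩ := hx
      obtain ⟨b, hb', rfl⟩ := hy
      have h3 := congrArg Prod.fst hxy
      have h4 := congrArg Prod.snd hxy
      refine hc a b ha hb' (Prod.ext ?_ h4)
      exact hβ _ (hl a (List.mem_of_head? ha)) _ (hl b (List.mem_of_getLast? hb')) h3
    · rw [hb, tw hVr, tw hQr]; exact tw hr
    · rw [tw hVr]; exact hV
    · unfold syll; rw [tw hQr]; exact hs

/-- suffixes of the given word -/
def Suf (w u : FG n) : Prop := u.toWord <:+ w.toWord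

theorem Suf.of_app {w v : FG n} (h : Suf w v) {t s : List (Fin n × Bool)}
    (hv : v.toWord = t ++ s) : Suf w (FreeGroup.mk s) := by
  have h1 : s <:+ w.toWord := List.IsSuffix.trans ⟨t, hv.symm⟩ h
  unfold Suf
  rw [tw (red_infix FreeGroup.isReduced_toWord h1.isInfix)]
  exact h1

theorem tree0 {w u u' : FG n} (hu : Suf w u) (hu' : Suf w u') :
    (∃ t, FreeGroup.IsReduced t ∧ t <:+: w.toWord ∧ u'.toWord = t ++ u.toWord ∧
      u' * u⁻¹ = FreeGroup.mk t) ∨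
    (∃ t, FreeGroup.IsReduced t ∧ t <:+: w.toWord ∧ u.toWord = t ++ u'.toWord ∧
      u * u'⁻¹ = FreeGroup.mk t) := by
  have aux : ∀ u u' : FG n, Suf w u' → u.toWord <:+ u'.toWord →
      (∃ t, FreeGroup.IsReduced t ∧ t <:+: w.toWord ∧ u'.toWord = t ++ u.toWord ∧
      u' * u⁻¹ = FreeGroup.mk t) := by
    rintro u u' hu' ⟨t, ht⟩
    have h1 : t <:+: u'.toWord := ⟨[], u.toWord, by simpa using ht⟩
    refine ⟨t, red_infix FreeGroup.isReduced_toWord h1, h1.trans hu'.isInfix, ht.symm, ?_⟩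
    rw [mul_inv_eq_iff_eq_mul]
    conv_lhs => rw [← FreeGroup.mk_toWord (x := u'), ← ht, ← FreeGroup.mul_mk, FreeGroup.mk_toWord]
  rcases List.suffix_or_suffix_of_suffix hu hu' with h | h
  · exact Or.inl (aux u u' hu' h)
  · exact Or.inr (aux u' u hu h)

theorem tree {w u u' : FG n} (hu : Suf w u) (hu' : Suf w u') {t1 s1 : List (Fin n × Bool)}
    (h : (u' * u⁻¹).toWord = t1 ++ s1) : Suf w (FreeGroup.mk s1 * u) := by
  rcases tree0 hu hu' with ⟨t, htr, -, hw, ht⟩ | ⟨t, htr, -, hw, ht⟩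
  · rw [ht, tw htr] at h
    rw [h, List.append_assoc] at hw
    have := hu'.of_app hw
    rwa [← FreeGroup.mul_mk, FreeGroup.mk_toWord] at this
  · have h2 : (u' * u⁻¹) = (FreeGroup.mk t)⁻¹ := by rw [← ht]; group
    rw [h2, FreeGroup.toWord_inv, tw htr] at h
    have h3 : t = FreeGroup.invRev s1 ++ FreeGroup.invRev t1 := by
      rw [← FreeGroup.invRev_append, ← h, FreeGroup.invRev_invRev]
    rw [h3, List.append_assoc] at hw
    have := hu.of_app hw
    have h4 : u = (FreeGroup.mk s1)⁻¹ * FreeGroup.mk (FreeGroup.invRev t1 ++ u'.toWord) := by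
      rw [FreeGroup.inv_mk, FreeGroup.mul_mk, ← hw, FreeGroup.mk_toWord]
    rw [h4, mul_inv_cancel_left]
    exact this

theorem tree_inf {w u u' : FG n} (hu : Suf w u) (hu' : Suf w u') :
    (u' * u⁻¹).toWord <:+: w.toWord ∨ (u' * u⁻¹)⁻¹.toWord <:+: w.toWord := by
  rcases tree0 hu hu' with ⟨t, htr, hi, hw, ht⟩ | ⟨t, htr, hi, hw, ht⟩
  · left; rw [ht, tw htr]; exact hi
  · right
    have h2 : (u' * u⁻¹)⁻¹ = (FreeGroup.mk t) := by rw [← ht]; group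
    rw [h2, tw htr]; exact hi

theorem claim (hsym : ∀ i j, M i j = M j i) {w : FG n} (hred : ArtinReduced n M w) {e : Ed n}
    {x y : FG n} {k l i : Fin n} {m p q : ℤ} (hk : k ∈ e.1) (hl : l ∈ e.1) (hi : i ∈ e.1)
    (hx : Suf w (FreeGroup.of k ^ m * x)) (hy : Suf w (FreeGroup.of l ^ p * y))
    (hxy : y * x⁻¹ ∈ Hc e)
    (hpe : PresentedGroup.mk (relsE n M e) y =
      PresentedGroup.mk (relsE n M e) (FreeGroup.of i ^ q * x)) :
    y = FreeGroup.of i ^ q * x := by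
  set φ := PresentedGroup.mk (relsE n M e) with hφ
  set h := (FreeGroup.of l ^ p * y) * (FreeGroup.of k ^ m * x)⁻¹ with hh
  set g := FreeGroup.of l ^ p * (FreeGroup.of i ^ q * FreeGroup.of k ^ (-m)) with hg
  have hginv : g⁻¹ = FreeGroup.of k ^ m * (FreeGroup.of i ^ (-q) * FreeGroup.of l ^ (-p)) := by
    rw [hg]; group
  have hH : h ∈ Hc e := by
    have : h = FreeGroup.of l ^ p * (y * x⁻¹) * (FreeGroup.of k ^ m)⁻¹ := by rw [hh]; group
    rw [this]
    exact mul_mem (mul_mem (zpow_mem (Hc_of hl) _) hxy) (inv_mem (zpow_mem (Hc_of hk) _))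
  have gH : g ∈ Hc e :=
    mul_mem (zpow_mem (Hc_of hl) _) (mul_mem (zpow_mem (Hc_of hi) _) (zpow_mem (Hc_of hk) _))
  have hpe2 : φ h = φ g := by
    have e1 : h = FreeGroup.of l ^ p * y * (FreeGroup.of k ^ m * x)⁻¹ := hh
    have e2 : g = FreeGroup.of l ^ p * (FreeGroup.of i ^ q * x) * (FreeGroup.of k ^ m * x)⁻¹ := by
      rw [hg]; group
    rw [e1, e2, map_mul, map_mul, hpe, ← map_mul, ← map_mul]
  have hbad := bad hsym hred e
  have lett : ∀ a ∈ Hc e, ∀ b ∈ Hc e, ∀ c ∈ a.toWord ++ b.toWord, c.1 ∈ e.1 := by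
    intro a ha b hb c hc
    rcases List.mem_append.1 hc with h1 | h1
    · exact Hc_letters ha c h1
    · exact Hc_letters hb c h1
  have hfin : h = g := by
    rcases tree_inf hx hy with h1 | h1
    · have := cyc φ w.toWord (fun i => i ∈ e.1) hbad _ h.toWord g⁻¹.toWord le_rfl h1
        FreeGroup.isReduced_toWord FreeGroup.isReduced_toWord (lett _ hH _ (inv_mem gH))
        (by rw [hginv]; exact syllL_three _ _ _ _ _ _)
      rw [← FreeGroup.mul_mk, FreeGroup.mk_toWord, FreeGroup.mk_toWord, map_mul, map_inv,
        mul_inv_eq_one, mul_inv_eq_one] at this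
      exact this hpe2
    · have := cyc φ w.toWord (fun i => i ∈ e.1) hbad _ h⁻¹.toWord g.toWord le_rfl h1
        FreeGroup.isReduced_toWord FreeGroup.isReduced_toWord (lett _ (inv_mem hH) _ gH)
        (syllL_three _ _ _ _ _ _)
      rw [← FreeGroup.mul_mk, FreeGroup.mk_toWord, FreeGroup.mk_toWord, map_mul, map_inv,
        inv_mul_eq_one, inv_mul_eq_one] at this
      exact this hpe2
  have e3 : y = (FreeGroup.of l ^ p)⁻¹ * h * (FreeGroup.of k ^ m * x) := by rw [hh]; group
  rw [e3, hfin, hg]; group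

theorem conv0 {w : FG n} {x : FG n} {k l i : Fin n} {m p q : ℤ} (hq : q ≠ 0)
    (hx : Suf w (FreeGroup.of k ^ m * x))
    (hy : Suf w (FreeGroup.of l ^ p * (FreeGroup.of i ^ q * x))) :
    ∃ r : ℤ, Suf w (FreeGroup.of i ^ r * x) := by
  by_cases hk : k = i
  · subst hk; exact ⟨m, hx⟩
  by_cases hl : l = i
  · subst hl; refine ⟨p + q, ?_⟩
    rwa [← mul_assoc, ← zpow_add] at hy
  have h1 := toWord_three hl (Ne.symm hk) p hq (-m)
  rw [← List.append_assoc] at h1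
  have h2 : FreeGroup.of l ^ p * (FreeGroup.of i ^ q * FreeGroup.of k ^ (-m)) =
      FreeGroup.of l ^ p * (FreeGroup.of i ^ q * x) * (FreeGroup.of k ^ m * x)⁻¹ := by group
  rw [h2] at h1
  have := tree hx hy h1
  rw [FreeGroup.mk_toWord, ← mul_assoc, ← zpow_add, neg_add_cancel] at this
  exact ⟨0, by rwa [zpow_zero] at this ⊢⟩

theorem two0 {w : FG n} {x : FG n} {k l : Fin n} {m p : ℤ} (hkl : l ≠ k)
    (hx : Suf w (FreeGroup.of k ^ m * x))
    (hy : Suf w (FreeGroup.of l ^ p * x)) : Suf w x := by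
  have h1 := toWord_two hkl p (-m)
  have h2 : FreeGroup.of l ^ p * FreeGroup.of k ^ (-m) =
      FreeGroup.of l ^ p * x * (FreeGroup.of k ^ m * x)⁻¹ := by group
  rw [h2] at h1
  have := tree hx hy h1
  rwa [FreeGroup.mk_toWord, ← mul_assoc, ← zpow_add, neg_add_cancel, zpow_zero, one_mul] at this

end Final

section Last

variable {n : ℕ} {M : Fin n → Fin n → ℕ∞}

abbrev X0 (w : FG n) := {g : FG n // ∃ i, ∃ k : ℤ, Suf w (FreeGroup.of i ^ k * g)}

def L0 (w : FG n) (i : Fin n) (g : X0 w) : Prop := ∃ k : ℤ, Suf w (FreeGroup.of i ^ k * g.1)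

theorem L0_s {w : FG n} {i : Fin n} {g : X0 w} (h : L0 w i g) (m : ℤ) :
    ∃ k : ℤ, Suf w (FreeGroup.of i ^ k * (FreeGroup.of i ^ m * g.1)) := by
  obtain ⟨k, hk⟩ := h
  refine ⟨k - m, ?_⟩
  rwa [← mul_assoc, ← zpow_add, sub_add_cancel]

open Classical in
noncomputable def s0 (w : FG n) (i : Fin n) (m : ℤ) (g : X0 w) : X0 w :=
  if h : L0 w i g then ⟨FreeGroup.of i ^ m * g.1, i, L0_s h m⟩ else g

theorem s0_pos {w : FG n} {i : Fin n} {m : ℤ} {g : X0 w} (h : L0 w i g) :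
    (s0 w i m g).1 = FreeGroup.of i ^ m * g.1 := by
  unfold s0; rw [dif_pos h]

theorem s0_neg {w : FG n} {i : Fin n} {m : ℤ} {g : X0 w} (h : ¬ L0 w i g) :
    s0 w i m g = g := by
  unfold s0; rw [dif_neg h]

theorem L0_s0 {w : FG n} {i : Fin n} (m : ℤ) {g : X0 w} (h : L0 w i g) : L0 w i (s0 w i m g) := by
  unfold L0
  rw [s0_pos h]
  exact L0_s h m

noncomputable def good0 (hsym : ∀ i j, M i j = M j i) (hM : ∀ i j, i ≠ j → 4 ≤ M i j)
    (w : FG n) (hred : ArtinReduced n M w) : Good1 (artSys n M hsym hM) (X0 w) where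
  L := L0 w
  s := s0 w
  s_zero i x := by
    by_cases h : L0 w i x
    · apply Subtype.ext; rw [s0_pos h, zpow_zero, one_mul]
    · rw [s0_neg h]
  s_add i m k x := by
    by_cases h : L0 w i x
    · apply Subtype.ext
      rw [s0_pos (L0_s0 k h), s0_pos h, s0_pos h, ← mul_assoc, ← zpow_add]
    · rw [s0_neg h, s0_neg h, s0_neg h]
  s_fix i m x h := s0_neg h
  L_s i m x h := L0_s0 m h
  L_ex x := x.2
  L_two {i j x} hi hj hij k := by
    obtain ⟨a, ha⟩ := hi
    obtain ⟨b, hb⟩ := hj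
    refine ⟨0, ?_⟩
    rw [zpow_zero, one_mul]
    exact two0 hij.symm ha hb
  K e := Set (FG n)
  kap (e : Ed n) x := {y | y * x.1⁻¹ ∈ Hc e}
  phi (e : Ed n) x := PresentedGroup.mk (relsE n M e) x.1
  kap_s {e i} m {x} he h := by
    ext y
    show y * _ ∈ Hc e ↔ y * _ ∈ Hc e
    rw [s0_pos h, mul_inv_rev, ← mul_assoc]
    exact Subgroup.mul_mem_cancel_right _ (inv_mem (zpow_mem (Hc_of he) m))
  phi_s {e i} m {x} he h := by
    show PresentedGroup.mk (relsE n M e) _ = PresentedGroup.of i ^ m * PresentedGroup.mk _ _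
    rw [s0_pos h, map_mul, map_zpow]; rfl
  inj {e x y} hx hy hk hp := by
    obtain ⟨i, hi, a, hx⟩ := hx
    obtain ⟨j, hj, b, hy⟩ := hy
    have h1 : y.1 * x.1⁻¹ ∈ Hc e := by
      have : y.1 ∈ {z | z * y.1⁻¹ ∈ Hc e} := by
        show y.1 * y.1⁻¹ ∈ Hc e
        rw [mul_inv_cancel]; exact one_mem _
      exact (Set.ext_iff.1 hk y.1).2 this
    have := claim hsym hred (q := 0) hi hj hi hx hy h1 (by rw [zpow_zero, one_mul]; exact hp.symm)
    rw [zpow_zero, one_mul] at this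
    exact (Subtype.ext this).symm
  conv {e x y i m} hx hy hk he hm hp := by
    obtain ⟨k, hi, a, hx⟩ := hx
    obtain ⟨j, hj, b, hy⟩ := hy
    have h1 : y.1 * x.1⁻¹ ∈ Hc e := by
      have : y.1 ∈ {z | z * y.1⁻¹ ∈ Hc e} := by
        show y.1 * y.1⁻¹ ∈ Hc e
        rw [mul_inv_cancel]; exact one_mem _
      exact (Set.ext_iff.1 hk y.1).2 this
    have := claim hsym hred (q := m) hi hj he hx hy h1 (by rw [map_mul, map_zpow]; exact hp)
    rw [this] at hy
    exact conv0 hm hx hy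

theorem Suf.mem {w u : FG n} (i : Fin n) (h : Suf w u) : ∃ k : ℤ, Suf w (FreeGroup.of i ^ k * u) :=
  ⟨0, by rwa [zpow_zero, one_mul]⟩

theorem path0 (hsym : ∀ i j, M i j = M j i) (hM : ∀ i j, i ≠ j → 4 ≤ M i j)
    (w : FG n) (hred : ArtinReduced n M w) (i0 : Fin n) (L : List (Fin n × Bool)) :
    ∀ (hL : Suf w (FreeGroup.mk L)) (h1 : Suf w 1) (_ : L <:+ w.toWord),
    Path (good0 hsym hM w hred) (FreeGroup.mk L) ⟨1, i0, h1.mem i0⟩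
      ⟨FreeGroup.mk L, i0, hL.mem i0⟩ := by
  induction L with
  | nil => intro _ _ _; exact Path.one _ _
  | cons a L ih =>
    intro hL h1 hs
    have hs' : L <:+ w.toWord := (List.suffix_cons a L).trans hs
    have hL' : Suf w (FreeGroup.mk L) := by
      unfold Suf
      rw [tw (red_infix FreeGroup.isReduced_toWord hs'.isInfix)]
      exact hs'
    have h2 := ih hL' h1 hs'
    obtain ⟨i, b⟩ := a
    let x : X0 w := ⟨FreeGroup.mk L, i0, hL'.mem i0⟩
    have hLx : L0 w i x := hL'.mem i
    cases b
    · have h3 := mk_cons_eq (i, false) L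
      have h4 : (⟨_, i0, hL.mem i0⟩ : X0 w) = s0 w i (-1) x := by
        apply Subtype.ext; rw [s0_pos hLx, zpow_neg_one]; exact h3
      rw [h4, h3]
      exact Path.mul (Path.of_inv (P := good0 hsym hM w hred) hLx) h2
    · have h3 := mk_cons_eq (i, true) L
      have h4 : (⟨_, i0, hL.mem i0⟩ : X0 w) = s0 w i 1 x := by
        apply Subtype.ext; rw [s0_pos hLx, zpow_one]; exact h3
      rw [h4, h3]
      exact Path.mul (Path.of (P := good0 hsym hM w hred) hLx) h2

theorem alt_mem {e : Ed n} {i j : Fin n} (hi : i ∈ e.1) (hj : j ∈ e.1) (m : ℕ) :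
    altWord i j m ∈ Hc e := by
  induction m generalizing i j with
  | zero => exact one_mem _
  | succ m ih => exact mul_mem (Hc_of hi) (ih hj hi)

theorem pie_eq (hsym : ∀ i j, M i j = M j i) (hM : ∀ i j, i ≠ j → 4 ≤ M i j) (e : Ed n) :
    pie (artSys n M hsym hM) e = PresentedGroup.mk (relsE n M e) := by
  apply FreeGroup.ext_hom (M := PresentedGroup (relsE n M e))
  intro i
  exact FreeGroup.lift_apply_of

theorem final (hsym : ∀ i j, M i j = M j i) (hM : ∀ i j, i ≠ j → 4 ≤ M i j)
    (w : FreeGroup (Fin n)) (hw : w ≠ 1) (hred : ArtinReduced n M w) :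
    artinMk n M w ≠ 1 := by
  intro h
  have hne : w.toWord ≠ [] := by
    rw [Ne, FreeGroup.toWord_eq_nil_iff]; exact hw
  obtain ⟨a, l, hal⟩ := List.exists_cons_of_ne_nil hne
  have : Nonempty (Fin n) := ⟨a.1⟩
  have hr : ∀ r ∈ artinRels n M, ∃ e : (artSys n M hsym hM).E,
      r ∈ He (artSys n M hsym hM) e ∧ pie (artSys n M hsym hM) e r = 1 := by
    rintro r ⟨i, j, hij, m, hm, rfl⟩
    let e : Ed n := ⟨s(i, j), by simpa using hij⟩
    have hi : i ∈ e.1 := by simp [e]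
    have hj : j ∈ e.1 := by simp [e]
    refine ⟨e, ?_, ?_⟩
    · exact mul_mem (alt_mem hi hj m) (inv_mem (alt_mem hj hi m))
    · rw [pie_eq]
      exact PresentedGroup.one_of_mem (Or.inl ⟨i, j, hij, rfl, m, hm, rfl⟩)
  have h1 : Suf w 1 := by unfold Suf; rw [FreeGroup.toWord_one]; exact List.nil_suffix
  have hL : Suf w (FreeGroup.mk w.toWord) := by rw [FreeGroup.mk_toWord]; exact List.suffix_rfl
  have hp := path0 hsym hM w hred a.1 w.toWord hL h1 List.suffix_rfl
  have h3 : PresentedGroup.mk (artinRels n M) (FreeGroup.mk w.toWord) = 1 := by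
    rw [FreeGroup.mk_toWord]; exact h
  have h2 := abstract_main (good0 hsym hM w hred) (artinRels n M) hr h3 hp
  have h4 := congrArg Subtype.val h2
  simp only [FreeGroup.mk_toWord] at h4
  exact hw h4.symm

end Last

end ArtinAux

/-- In an Artin group with all labels `m_{ij} ≥ 4`, every nonempty Artin-reduced
word represents a nontrivial element of `G`. -/
theorem artinReduced_ne_one (n : ℕ) (M : Fin n → Fin n → ℕ∞)
    (hsym : ∀ i j, M i j = M j i) (hM : ∀ i j, i ≠ j → 4 ≤ M i j)
    (w : FreeGroup (Fin n)) (hw : w ≠ 1) (hred : ArtinReduced n M w) :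
    artinMk n M w ≠ 1 := by
  exact ArtinAux.final hsym hM w hw hred
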